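/- arXiv:1312.7132 — 3 statements merged into one kernel-verified Lean document; each statement's English description precedes it below -/
import Mathlib

section
/- Let Y1, Y2 be independent positive random variables such that Y1 is in the Gumbel max-domain of attraction with auxiliary function a which is regularly varying at infinity with index -τ for some τ ≥ -1, and Y2 has distribution with right endpoint equal to 1. Then the product X = Y1·Y2 is also in the Gumbel max-domain of attraction with the same auxiliary function a, i.e. P(Y1Y2 > u + a(u)t)/P(Y1Y2 > u) → e^{-t} for all t ≥ 0. -/
open MeasureTheory ProbabilityTheory Filter Topology Real

/-- `g` is regularly varying at infinity with index `ρ`. -/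
def RegularlyVarying (g : ℝ → ℝ) (ρ : ℝ) : Prop :=
  ∀ x : ℝ, 0 < x → Filter.Tendsto (fun u => g (u * x) / g u) Filter.atTop (nhds (x ^ ρ))


theorem uct_aux (f : ℝ → ℝ) (hf : Measurable f)
    (hlim : ∀ h : ℝ, Tendsto (fun x => f (x + h) - f x) atTop (𝓝 0)) (ε : ℝ) (hε : 0 < ε) :
    ∃ X : ℝ, ∀ x ≥ X, ∀ h : ℝ, 0 ≤ h → h ≤ 1 → |f (x + h) - f x| ≤ ε := by
  by_contra hcon
  push Not at hcon
  choose x hx h h0 h1 hbad using fun n : ℕ => hcon n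
  have key : ∀ z : ℕ → ℝ, Tendsto z atTop atTop →
      ∃ n0 : ℕ, ∀ n ≥ n0, ENNReal.ofReal (3/2) < volume
        {y : ℝ | y ∈ Set.Icc (0:ℝ) 2 ∧ ∀ m ≥ n, |f (z m + y) - f (z m)| ≤ ε / 2} := by
    intro z hz
    set V : ℕ → Set ℝ := fun n =>
      {y : ℝ | y ∈ Set.Icc (0:ℝ) 2 ∧ ∀ m ≥ n, |f (z m + y) - f (z m)| ≤ ε / 2} with hV
    have hmono : Monotone V := fun n k hnk y hy => ⟨hy.1, fun m hm => hy.2 m (hnk.trans hm)⟩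
    have hU : ⋃ n, V n = Set.Icc (0:ℝ) 2 := by
      ext y
      simp only [Set.mem_iUnion]
      constructor
      · rintro ⟨n, hn⟩
        exact hn.1
      · intro hy
        have h3 := ((hlim y).comp hz).abs
        simp only [abs_zero] at h3
        have h4 := h3.eventually (ge_mem_nhds (show (0:ℝ) < ε / 2 by linarith))
        obtain ⟨n, hn⟩ := eventually_atTop.1 h4
        exact ⟨n, hy, hn⟩
    have ht := tendsto_measure_iUnion_atTop (μ := volume) hmono
    rw [hU, Real.volume_Icc] at ht
    have h5 := ht.eventually (lt_mem_nhds (show ENNReal.ofReal (3/2) < ENNReal.ofReal (2 - 0) by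
      rw [ENNReal.ofReal_lt_ofReal_iff] <;> norm_num))
    exact eventually_atTop.1 h5
  have hx1 : Tendsto x atTop atTop := tendsto_atTop_mono hx tendsto_natCast_atTop_atTop
  have hx2 : Tendsto (fun n => x n + h n) atTop atTop :=
    tendsto_atTop_mono (fun n => by linarith [h0 n, hx n]) hx1
  obtain ⟨n1, hn1⟩ := key x hx1
  obtain ⟨n2, hn2⟩ := key _ hx2
  set n := max n1 n2
  have hv := hn1 n (le_max_left _ _)
  have hw := hn2 n (le_max_right _ _)
  set V := {y : ℝ | y ∈ Set.Icc (0:ℝ) 2 ∧ ∀ m ≥ n, |f (x m + y) - f (x m)| ≤ ε / 2} with hV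
  set W := {y : ℝ | y ∈ Set.Icc (0:ℝ) 2 ∧ ∀ m ≥ n, |f (x m + h m + y) - f (x m + h m)| ≤ ε / 2}
    with hW
  have hWm : MeasurableSet W := by
    have : W = Set.Icc (0:ℝ) 2 ∩ ⋂ m, ⋂ (_ : m ≥ n),
        {y | |f (x m + h m + y) - f (x m + h m)| ≤ ε / 2} := by
      ext y; simp [hW]
    rw [this]
    refine measurableSet_Icc.inter (MeasurableSet.iInter fun m => MeasurableSet.iInter fun _ => ?_)
    refine measurableSet_le ?_ measurable_const
    exact ((hf.comp (measurable_const.add measurable_id)).sub_const _).abs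
  have hW' : MeasurableSet ((fun y => y - h n) ⁻¹' W) := (measurable_id.sub_const _) hWm
  have hne : (V ∩ ((fun y => y - h n) ⁻¹' W)).Nonempty := by
    refine nonempty_inter_of_measure_lt_add volume hW' (u := Set.Icc (0:ℝ) 3) ?_ ?_ ?_
    · intro y hy
      exact ⟨hy.1.1, by linarith [hy.1.2]⟩
    · intro y hy
      have h6 := hy.1.1
      have h7 := hy.1.2
      have := h0 n
      have := h1 n
      exact ⟨by linarith, by linarith⟩
    · have e1 : volume ((fun y => y - h n) ⁻¹' W) = volume W := by
        simp only [sub_eq_add_neg]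
        exact measure_preimage_add_right volume _ _
      rw [e1, Real.volume_Icc]
      have : ENNReal.ofReal (3 - 0) = ENNReal.ofReal (3/2) + ENNReal.ofReal (3/2) := by
        rw [← ENNReal.ofReal_add] <;> norm_num
      rw [this]
      exact ENNReal.add_lt_add hv hw
  obtain ⟨y, hy1, hy2⟩ := hne
  have a1 := hy1.2 n le_rfl
  have a2 := hy2.2 n le_rfl
  have a3 := hbad n
  rw [show x n + h n + (y - h n) = x n + y by ring] at a2
  rw [abs_le] at a1 a2
  have : |f (x n + h n) - f (x n)| ≤ ε := abs_le.2 ⟨by linarith, by linarith⟩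
  linarith

section
variable {F a : ℝ → ℝ}

theorem gum_up (hpos : ∀ u, 0 < F u) {t c : ℝ}
    (hG : Tendsto (fun u => F (u + a u * t) / F u) atTop (𝓝 (Real.exp (-t))))
    (hc : Real.exp (-t) < c) : ∀ᶠ u in atTop, F (u + a u * t) < c * F u := by
  filter_upwards [hG.eventually (gt_mem_nhds hc)] with u hu
  exact (div_lt_iff₀ (hpos u)).1 hu

theorem gum_lo (hpos : ∀ u, 0 < F u) {t c : ℝ}
    (hG : Tendsto (fun u => F (u + a u * t) / F u) atTop (𝓝 (Real.exp (-t))))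
    (hc : c < Real.exp (-t)) : ∀ᶠ u in atTop, c * F u < F (u + a u * t) := by
  filter_upwards [hG.eventually (lt_mem_nhds hc)] with u hu
  exact (lt_div_iff₀ (hpos u)).1 hu

theorem self_negl (hpos : ∀ u, 0 < F u) (hF : Antitone F) (ha : ∀ u > 0, 0 < a u)
    (hG : ∀ t : ℝ, 0 ≤ t → Tendsto (fun u => F (u + a u * t) / F u) atTop (𝓝 (Real.exp (-t))))
    {ε : ℝ} (hε : 0 < ε) : ∀ᶠ u in atTop, a (u + a u) ≤ (1 + ε) * a u := by
  have hv : Tendsto (fun u => u + a u) atTop atTop := by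
    refine tendsto_atTop_mono' _ ?_ tendsto_id
    filter_upwards [eventually_gt_atTop 0] with u hu
    have := ha u hu
    simp; linarith
  have h1 := gum_up hpos (hG (2 + ε) (by linarith))
    (c := Real.exp (-(2 + ε/2))) (by apply Real.exp_lt_exp.2; linarith)
  have h2 := gum_lo hpos (hG 1 (by linarith)) (c := Real.exp (-(1 + ε/4)))
    (by apply Real.exp_lt_exp.2; linarith)
  filter_upwards [h1, h2, hv.eventually h2] with u k1 k2 k3
  by_contra hcon
  push Not at hcon
  simp only [mul_one] at k2 k3
  have k4 : F (u + a u + a (u + a u)) ≤ F (u + a u * (2 + ε)) := hF (by linarith)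
  have k5 : Real.exp (-(1 + ε/4)) * (Real.exp (-(1 + ε/4)) * F u) <
      Real.exp (-(1 + ε/4)) * F (u + a u) := by
    exact mul_lt_mul_of_pos_left k2 (Real.exp_pos _)
  rw [← mul_assoc, ← Real.exp_add] at k5
  rw [show -(1 + ε/4) + -(1 + ε/4) = -(2 + ε/2) by ring] at k5
  linarith

theorem crude (hpos : ∀ u, 0 < F u) (hF : Antitone F) (ha : ∀ u > 0, 0 < a u)
    (hG : ∀ t : ℝ, 0 ≤ t → Tendsto (fun u => F (u + a u * t) / F u) atTop (𝓝 (Real.exp (-t)))) :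
    ∀ᶠ u in atTop, ∀ v, u ≤ v → v ≤ u + a u → a v ≤ 3 * a u := by
  have h1 := gum_up hpos (hG 3 (by linarith))
    (c := Real.exp (-(5/2))) (by apply Real.exp_lt_exp.2; norm_num)
  have h2 := gum_lo hpos (hG 1 (by linarith)) (c := Real.exp (-(5/4)))
    (by apply Real.exp_lt_exp.2; norm_num)
  filter_upwards [h1, h2, eventually_forall_ge_atTop.2 h2] with u k1 k2 k3' v huv hvu
  by_contra hcon
  push Not at hcon
  have k3 := k3' v huv
  simp only [mul_one] at k2 k3
  have k4 : F (v + a v) ≤ F (u + a u * 3) := hF (by linarith)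
  have k6 : F (u + a u) ≤ F v := hF hvu
  have k5 : Real.exp (-(5/4)) * (Real.exp (-(5/4)) * F u) <
      Real.exp (-(5/4)) * F v := by
    exact mul_lt_mul_of_pos_left (by linarith) (Real.exp_pos _)
  rw [← mul_assoc, ← Real.exp_add] at k5
  rw [show (-(5/4) + -(5/4) : ℝ) = -(5/2) by ring] at k5
  linarith

theorem a_little (hpos : ∀ u, 0 < F u) (hF : Antitone F) (ha : ∀ u > 0, 0 < a u)
    (hG : ∀ t : ℝ, 0 ≤ t → Tendsto (fun u => F (u + a u * t) / F u) atTop (𝓝 (Real.exp (-t))))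
    {ε : ℝ} (hε : 0 < ε) : ∀ᶠ u in atTop, a u ≤ ε * u := by
  have h1 := self_negl hpos hF ha hG (ε := ε/6) (by linarith)
  have h2 := crude hpos hF ha hG
  have h3 := gum_up hpos (hG 1 (by linarith))
    (c := Real.exp (-(1/2))) (by apply Real.exp_lt_exp.2; norm_num)
  obtain ⟨u0, hu0⟩ := eventually_atTop.1 ((h1.and (h2.and h3)).and (eventually_gt_atTop 0))
  let s : ℕ → ℝ := fun n => (fun u => u + a u)^[n] u0
  have s0 : s 0 = u0 := rfl
  have ss : ∀ n, s (n+1) = s n + a (s n) := fun n => by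
    simp only [s, Function.iterate_succ_apply']
  have hge : ∀ n, u0 ≤ s n := by
    intro n
    induction n with
    | zero => exact le_rfl
    | succ n ih =>
      rw [ss]
      have := ha _ (hu0 _ ih).2
      linarith
  have hA : ∀ n, a (s n) ≤ a u0 + ε/6 * (s n - u0) := by
    intro n
    induction n with
    | zero => simp [s0]
    | succ n ih =>
      have := (hu0 _ (hge n)).1.1
      rw [ss]
      nlinarith
  have hB : ∀ n, F (s n) ≤ Real.exp (-(1/2)) ^ n * F u0 := by
    intro n
    induction n with
    | zero => simp [s0]
    | succ n ih =>
      have := (hu0 _ (hge n)).1.2.2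
      rw [ss, pow_succ']
      simp only [mul_one] at this
      have := mul_le_mul_of_nonneg_left ih (Real.exp_pos (-(1/2))).le
      linarith
  have hunb : ∀ v, ∃ n, v < s n := by
    intro v
    by_contra hcon
    push Not at hcon
    have hl : Tendsto (fun n : ℕ => Real.exp (-(1/2)) ^ n * F u0) atTop (𝓝 (0 * F u0)) :=
      (tendsto_pow_atTop_nhds_zero_of_lt_one (Real.exp_pos _).le
        (by rw [Real.exp_lt_one_iff]; norm_num)).mul_const _
    rw [zero_mul] at hl
    have := ge_of_tendsto' hl (fun n => (hF (hcon n)).trans (hB n))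
    linarith [hpos v]
  have hlarge := eventually_ge_atTop (6 * a u0 / ε)
  filter_upwards [eventually_ge_atTop u0, hlarge] with v hv hv2
  classical
  have hex := hunb v
  obtain ⟨k, hk⟩ : ∃ k, Nat.find hex = k + 1 := by
    refine Nat.exists_eq_succ_of_ne_zero ?_
    intro h0
    have := Nat.find_spec hex
    rw [h0, s0] at this
    linarith
  have e1 := Nat.find_spec hex
  rw [hk, ss] at e1
  have e2 := Nat.find_min hex (m := k) (by omega)
  push Not at e2
  have e3 := (hu0 _ (hge k)).1.2.1 v e2 e1.le
  have e4 := hA k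
  have e5 : 6 * a u0 ≤ v * ε := (div_le_iff₀ hε).1 hv2
  have e6 := (hu0 u0 le_rfl).2
  nlinarith

theorem rapid (hpos : ∀ u, 0 < F u) (hF : Antitone F) (ha : ∀ u > 0, 0 < a u)
    (hG : ∀ t : ℝ, 0 ≤ t → Tendsto (fun u => F (u + a u * t) / F u) atTop (𝓝 (Real.exp (-t))))
    {c κ : ℝ} (hc : 1 < c) (hκ : 0 < κ) : ∀ᶠ u in atTop, F (c * u) ≤ κ * F u := by
  obtain ⟨t, ht0, ht⟩ : ∃ t : ℝ, 0 < t ∧ Real.exp (-t) < κ := by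
    have := (Real.tendsto_exp_neg_atTop_nhds_zero.eventually (gt_mem_nhds hκ)).and
      (eventually_gt_atTop 0)
    obtain ⟨t, h1, h2⟩ := this.exists
    exact ⟨t, h2, h1⟩
  filter_upwards [gum_up hpos (hG t ht0.le) ht,
    a_little hpos hF ha hG (ε := (c - 1) / t) (by apply div_pos <;> linarith)] with u h1 h2
  have : a u * t ≤ (c - 1) * u := by
    have := mul_le_mul_of_nonneg_right h2 ht0.le
    rwa [show (c - 1) / t * u * t = (c-1) * u by field_simp] at this
  have : F (c * u) ≤ F (u + a u * t) := hF (by linarith)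
  linarith

theorem a_unif (hpos : ∀ u, 0 < F u) (hF : Antitone F) (hF0 : Tendsto F atTop (𝓝 0))
    (ha : ∀ u > 0, 0 < a u)
    (hG : ∀ t : ℝ, 0 ≤ t → Tendsto (fun u => F (u + a u * t) / F u) atTop (𝓝 (Real.exp (-t))))
    {ρ : ℝ} (hRV : ∀ x : ℝ, 0 < x → Tendsto (fun u => a (u * x) / a u) atTop (𝓝 (x ^ ρ)))
    {ε : ℝ} (hε : 0 < ε) : ∃ δ > 0, ∀ᶠ u in atTop, ∀ w, u ≤ w → w ≤ u * Real.exp δ →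
      |Real.log (a w) - Real.log (a u)| ≤ ε := by
  set S : ℝ → Set ℝ := fun u => {s | 0 ≤ s ∧ F (u + s) ≤ Real.exp (-1) * F u} with hS
  set b : ℝ → ℝ := fun u => sInf (S u) with hb
  have hbdd : ∀ u, BddBelow (S u) := fun u => ⟨0, fun s hs => hs.1⟩
  have hne : ∀ u, (S u).Nonempty := by
    intro u
    have h1 : Tendsto (fun s => F (u + s)) atTop (𝓝 0) :=
      hF0.comp (tendsto_atTop_add_const_left _ _ tendsto_id)
    have h2 := h1.eventually (ge_mem_nhds (mul_pos (Real.exp_pos (-1)) (hpos u)))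
    obtain ⟨s, h3, h4⟩ := (h2.and (eventually_ge_atTop 0)).exists
    exact ⟨s, h4, h3⟩
  have hbm : Measurable b := by
    refine measurable_of_Iio fun s => ?_
    have : b ⁻¹' Set.Iio s = ⋃ q : ℚ, {u | (0 ≤ (q:ℝ) ∧ (q:ℝ) < s) ∧
        F (u + q) ≤ Real.exp (-1) * F u} := by
      ext u
      simp only [Set.mem_preimage, Set.mem_Iio, Set.mem_iUnion, Set.mem_ofPred_eq]
      rw [hb]
      simp only
      rw [csInf_lt_iff (hbdd u) (hne u)]
      constructor
      · rintro ⟨r, ⟨hr0, hr1⟩, hr2⟩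
        obtain ⟨q, hq1, hq2⟩ := exists_rat_btwn hr2
        exact ⟨q, ⟨by linarith, hq2⟩, (hF (by linarith)).trans hr1⟩
      · rintro ⟨q, ⟨h1, h2⟩, h3⟩
        exact ⟨q, ⟨h1, h3⟩, h2⟩
    rw [this]
    refine MeasurableSet.iUnion fun q => (MeasurableSet.const _).inter ?_
    exact measurableSet_le (hF.measurable.comp (measurable_id.add_const _))
      (hF.measurable.const_mul _)
  -- b ~ a
  have hba : ∀ η > 0, ∀ᶠ u in atTop, 0 < b u ∧ |Real.log (b u) - Real.log (a u)| ≤ η := by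
    intro η hη
    have h1 := gum_up hpos (hG (Real.exp η) (Real.exp_pos _).le) (c := Real.exp (-1))
      (by apply Real.exp_lt_exp.2; have := Real.add_one_lt_exp hη.ne'; linarith)
    have h2 := gum_lo hpos (hG (Real.exp (-η)) (Real.exp_pos _).le) (c := Real.exp (-1))
      (by apply Real.exp_lt_exp.2
          have : Real.exp (-η) < 1 := by rw [Real.exp_lt_one_iff]; linarith
          linarith)
    filter_upwards [h1, h2, eventually_gt_atTop 0] with u k1 k2 k3
    have hau := ha u k3
    have b1 : b u ≤ a u * Real.exp η :=
      csInf_le (hbdd u) ⟨by positivity, k1.le⟩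
    have b2 : a u * Real.exp (-η) ≤ b u := by
      refine le_csInf (hne u) fun s hs => ?_
      by_contra hcon
      push Not at hcon
      have := hF (show u + s ≤ u + a u * Real.exp (-η) by linarith)
      linarith [hs.2]
    have hbp : 0 < b u := lt_of_lt_of_le (by positivity) b2
    refine ⟨hbp, ?_⟩
    have c1 := Real.log_le_log hbp b1
    have c2 := Real.log_le_log (by positivity) b2
    rw [Real.log_mul hau.ne' (Real.exp_pos _).ne', Real.log_exp] at c1 c2
    exact abs_le.2 ⟨by linarith, by linarith⟩
  have hba0 : Tendsto (fun u => Real.log (b u) - Real.log (a u)) atTop (𝓝 0) := by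
    rw [Metric.tendsto_nhds]
    intro η hη
    filter_upwards [hba (η/2) (by linarith)] with u hu
    rw [Real.dist_eq, sub_zero]
    linarith [hu.2]
  let f : ℝ → ℝ := fun x => Real.log (b (Real.exp x)) - ρ * x
  have hfm : Measurable f := by
    have := Real.measurable_log.comp (hbm.comp Real.measurable_exp)
    exact this.sub (measurable_id.const_mul ρ)
  have hflim : ∀ h : ℝ, Tendsto (fun x => f (x + h) - f x) atTop (𝓝 0) := by
    intro h
    have h1 := (hRV (Real.exp h) (Real.exp_pos h)).comp Real.tendsto_exp_atTop
    have h2 := h1.log (by positivity)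
    have h3 : Real.log (Real.exp h ^ ρ) = ρ * h := by
      rw [Real.log_rpow (Real.exp_pos _), Real.log_exp]
    rw [h3] at h2
    have h4 := hba0.comp Real.tendsto_exp_atTop
    have h5 := h4.comp (tendsto_atTop_add_const_right _ h tendsto_id)
    have h6 := ((h2.add h5).sub h4).sub_const (ρ * h)
    have e0 : ρ * h + 0 - 0 - ρ * h = 0 := by ring
    rw [e0] at h6
    refine h6.congr fun x => ?_
    have p1 := (ha (Real.exp x * Real.exp h) (by positivity)).ne'
    have p2 := (ha (Real.exp x) (by positivity)).ne'
    simp only [Function.comp, f, id]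
    rw [Real.log_div p1 p2, Real.exp_add]
    ring
  obtain ⟨X, hX⟩ := uct_aux f hfm hflim (ε/4) (by linarith)
  set δ := min 1 (ε / (4 * (|ρ| + 1))) with hδ
  have hδ0 : 0 < δ := by
    have : 0 < ε / (4 * (|ρ| + 1)) := by positivity
    exact lt_min one_pos this
  refine ⟨δ, hδ0, ?_⟩
  have hba' := hba (ε/4) (by linarith)
  filter_upwards [eventually_ge_atTop (Real.exp X), hba', eventually_forall_ge_atTop.2 hba']
    with u hu1 hu2 hu3 w hw1 hw2
  have hup : 0 < u := lt_of_lt_of_le (Real.exp_pos _) hu1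
  have hwp : 0 < w := lt_of_lt_of_le hup hw1
  set h := Real.log w - Real.log u with hh
  have l1 : Real.log u ≤ Real.log w := Real.log_le_log hup hw1
  have l2 : Real.log w ≤ Real.log u + δ := by
    have := Real.log_le_log hwp hw2
    rwa [Real.log_mul hup.ne' (Real.exp_pos _).ne', Real.log_exp] at this
  have l3 : X ≤ Real.log u := (Real.le_log_iff_exp_le hup).2 hu1
  have hd1 : δ ≤ 1 := min_le_left _ _
  have hd2 : δ * (4 * (|ρ| + 1)) ≤ ε := by
    have := min_le_right 1 (ε / (4 * (|ρ| + 1)))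
    exact (le_div_iff₀ (by positivity)).1 this
  have m := hX (Real.log u) l3 h (by linarith) (by linarith)
  have m2 : |ρ * h| ≤ ε / 4 := by
    rw [abs_mul, abs_of_nonneg (show 0 ≤ h by linarith)]
    have : |ρ| * h ≤ |ρ| * δ := mul_le_mul_of_nonneg_left (by linarith) (abs_nonneg _)
    nlinarith
  have m3 := (hu3 w hw1).2
  have m4 := hu2.2
  have ee : Real.log u + h = Real.log w := by rw [hh]; ring
  simp only [f] at m
  rw [ee, Real.exp_log hup, Real.exp_log hwp] at m
  have ew : Real.log w = Real.log u + h := ee.symm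
  rw [ew] at m
  rw [abs_le] at *
  constructor <;> nlinarith
end

theorem main_aux {F a : ℝ → ℝ} (hpos : ∀ u, 0 < F u) (hF : Antitone F) (hF1 : ∀ u, F u ≤ 1)
    (hF0 : Tendsto F atTop (𝓝 0))
    (ha : ∀ u > 0, 0 < a u)
    (hG : ∀ t : ℝ, 0 ≤ t → Tendsto (fun u => F (u + a u * t) / F u) atTop (𝓝 (Real.exp (-t))))
    {ρ : ℝ} (hRV : ∀ x : ℝ, 0 < x → Tendsto (fun u => a (u * x) / a u) atTop (𝓝 (x ^ ρ)))
    (G : Measure ℝ) [IsProbabilityMeasure G] (hG0 : ∀ᵐ y ∂G, 0 < y) (hG1 : ∀ᵐ y ∂G, y ≤ 1)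
    (hGend : ∀ w < 1, 0 < G (Set.Ioi w)) (t : ℝ) (ht : 0 ≤ t) {ε : ℝ} (hε : 0 < ε) :
    ∀ᶠ u in atTop, 0 < ∫ y, F (u / y) ∂G ∧
      ∫ y, F ((u + a u * t) / y) ∂G ≤
        (Real.exp (-(t * Real.exp (-ε))) + 2 * ε) * ∫ y, F (u / y) ∂G ∧
      (Real.exp (-(t * Real.exp (2 * ε))) - 2 * ε) * ∫ y, F (u / y) ∂G ≤
        ∫ y, F ((u + a u * t) / y) ∂G := by
  obtain ⟨δ', hδ', hunif⟩ := a_unif hpos hF hF0 ha hG hRV hε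
  set δ := min δ' ε with hδdef
  have hδ : 0 < δ := lt_min hδ' hε
  have hδε : δ ≤ ε := min_le_right _ _
  have hδδ : δ ≤ δ' := min_le_left _ _
  have hint : ∀ v : ℝ, Integrable (fun y => F (v / y)) G := by
    intro v
    refine Integrable.of_bound (C := 1)
      (hF.measurable.comp (measurable_const.div measurable_id)).aestronglyMeasurable ?_
    refine Eventually.of_forall fun y => ?_
    rw [Real.norm_eq_abs, abs_of_pos (hpos _)]
    exact hF1 _
  set A := Set.Ioi (Real.exp (-δ)) with hA
  have hAm : MeasurableSet A := measurableSet_Ioi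
  set p := G.real (Set.Ioi (Real.exp (-(δ/2)))) with hp
  have hp0 : 0 < p := by
    refine ENNReal.toReal_pos (hGend _ ?_).ne' (measure_ne_top _ _)
    rw [Real.exp_lt_one_iff]; linarith
  have hrap := rapid hpos hF ha hG (c := Real.exp (δ/2)) (κ := ε * p)
    (by rw [Real.one_lt_exp_iff]; linarith) (by positivity)
  have hrap2 : ∀ᶠ u in atTop, F (u * Real.exp δ) ≤ ε * p * F (u * Real.exp (δ/2)) := by
    have hten : Tendsto (fun u : ℝ => u * Real.exp (δ/2)) atTop atTop :=
      tendsto_id.atTop_mul_const (Real.exp_pos _)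
    filter_upwards [hten.eventually hrap] with u hu
    have : Real.exp (δ/2) * (u * Real.exp (δ/2)) = u * Real.exp δ := by
      rw [show δ = δ/2 + δ/2 by ring, Real.exp_add]; ring_nf
    rwa [this] at hu
  have hU := eventually_forall_ge_atTop.2 (gum_up hpos (hG (t * Real.exp (-ε)) (by positivity))
    (c := Real.exp (-(t * Real.exp (-ε))) + ε) (by linarith))
  have hL := eventually_forall_ge_atTop.2 (gum_lo hpos (hG (t * Real.exp (2*ε)) (by positivity))
    (c := Real.exp (-(t * Real.exp (2*ε))) - ε) (by linarith))
  filter_upwards [hunif, hrap2, hU, hL, eventually_gt_atTop 0] with u k1 k2 k3 k4 hu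
  have hau := ha u hu
  have heI : ∀ x : ℝ, u / Real.exp (-x) = u * Real.exp x := fun x => by
    rw [Real.exp_neg]; field_simp
  -- pointwise bounds on A
  have hptw : ∀ᵐ y ∂G, y ∈ A →
      F ((u + a u * t) / y) ≤ (Real.exp (-(t * Real.exp (-ε))) + ε) * F (u / y) ∧
      (Real.exp (-(t * Real.exp (2*ε))) - ε) * F (u / y) ≤ F ((u + a u * t) / y) := by
    filter_upwards [hG1] with y hy1 hyA
    have hyA' : Real.exp (-δ) < y := hyA
    have hy0 : 0 < y := (Real.exp_pos _).trans hyA'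
    have w1 : u ≤ u / y := (le_div_iff₀ hy0).2 (by nlinarith)
    have w2 : u / y ≤ u * Real.exp δ := by
      rw [← heI]; exact div_le_div_of_nonneg_left hu.le (Real.exp_pos _) hyA'.le
    have w3 : u / y ≤ u * Real.exp δ' :=
      w2.trans (mul_le_mul_of_nonneg_left (Real.exp_le_exp.2 hδδ) hu.le)
    have hw0 : 0 < u / y := by positivity
    have haw := ha _ hw0
    have q := abs_le.1 (k1 _ w1 w3)
    have q1 : a (u / y) ≤ a u * Real.exp ε := by
      rw [← Real.log_le_log_iff haw (by positivity), Real.log_mul hau.ne' (Real.exp_pos _).ne',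
        Real.log_exp]
      linarith
    have q2 : a u ≤ a (u / y) * Real.exp ε := by
      rw [← Real.log_le_log_iff hau (by positivity), Real.log_mul haw.ne' (Real.exp_pos _).ne',
        Real.log_exp]
      linarith
    have q3 : a (u / y) * Real.exp (-ε) ≤ a u := by
      rw [Real.exp_neg, ← div_eq_mul_inv, div_le_iff₀ (Real.exp_pos _)]; exact q1
    have q4 : a u ≤ a u / y := (le_div_iff₀ hy0).2 (by nlinarith)
    have q5 : a u / y ≤ a (u / y) * Real.exp (2*ε) := by
      have r1 : a u / y ≤ a u * Real.exp ε := by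
        rw [div_le_iff₀ hy0]
        have : 1 ≤ Real.exp ε * y := by
          have : Real.exp ε * Real.exp (-ε) ≤ Real.exp ε * y :=
            mul_le_mul_of_nonneg_left ((Real.exp_le_exp.2 (by linarith)).trans hyA'.le)
              (Real.exp_pos _).le
          rwa [← Real.exp_add, add_neg_cancel, Real.exp_zero] at this
        nlinarith
      have r2 := mul_le_mul_of_nonneg_right q2 (Real.exp_pos ε).le
      rw [mul_assoc, ← Real.exp_add, ← two_mul] at r2
      linarith
    have ed : (u + a u * t) / y = u / y + a u / y * t := by ring
    rw [ed]
    constructor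
    · refine le_trans (hF ?_) (k3 _ w1).le
      have := mul_le_mul_of_nonneg_right (q3.trans q4) ht
      linarith
    · refine le_trans (k4 _ w1).le (hF ?_)
      have := mul_le_mul_of_nonneg_right q5 ht
      linarith
  set I := ∫ y in A, F (u / y) ∂G with hI
  set J := ∫ y in Aᶜ, F (u / y) ∂G with hJ
  set I' := ∫ y in A, F ((u + a u * t) / y) ∂G with hI'
  set J' := ∫ y in Aᶜ, F ((u + a u * t) / y) ∂G with hJ'
  have hH : ∫ y, F (u / y) ∂G = I + J := (integral_add_compl hAm (hint u)).symm
  have hN : ∫ y, F ((u + a u * t) / y) ∂G = I' + J' := (integral_add_compl hAm (hint _)).symm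
  have hI0 : 0 ≤ I := integral_nonneg fun y => (hpos _).le
  have hJ0 : 0 ≤ J := integral_nonneg fun y => (hpos _).le
  have hJ'0 : 0 ≤ J' := integral_nonneg fun y => (hpos _).le
  have hJb : ∀ v, u ≤ v → ∫ y in Aᶜ, F (v / y) ∂G ≤ F (u * Real.exp δ) := by
    intro v hv
    have : ∫ y in Aᶜ, F (v / y) ∂G ≤ ∫ y in Aᶜ, F (u * Real.exp δ) ∂G := by
      refine setIntegral_mono_on_ae (hint v).integrableOn (integrable_const _).integrableOn
        hAm.compl ?_
      filter_upwards [hG0] with y hy0 hyA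
      have hyA' : y ≤ Real.exp (-δ) := by simpa [hA] using hyA
      refine hF ?_
      rw [← heI]
      exact div_le_div₀ (by linarith) hv hy0 hyA'
    refine this.trans ?_
    rw [setIntegral_const, smul_eq_mul]
    have h1 : G.real Aᶜ ≤ 1 := measureReal_le_one
    nlinarith [hpos (u * Real.exp δ)]
  have hIlow : p * F (u * Real.exp (δ/2)) ≤ I := by
    have h1 : ∫ y in Set.Ioi (Real.exp (-(δ/2))), F (u * Real.exp (δ/2)) ∂G ≤
        ∫ y in Set.Ioi (Real.exp (-(δ/2))), F (u / y) ∂G := by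
      refine setIntegral_mono_on (integrable_const _).integrableOn (hint u).integrableOn
        measurableSet_Ioi ?_
      intro y hy
      have hy' : Real.exp (-(δ/2)) < y := hy
      refine hF ?_
      rw [← heI]
      exact div_le_div_of_nonneg_left hu.le (Real.exp_pos _) hy'.le
    rw [setIntegral_const, smul_eq_mul] at h1
    refine h1.trans ?_
    refine setIntegral_mono_set (hint u).integrableOn
      (Eventually.of_forall fun y => (hpos _).le) ?_
    exact (Set.Ioi_subset_Ioi (Real.exp_le_exp.2 (by linarith))).eventuallyLE
  have hIpos : 0 < I := lt_of_lt_of_le (mul_pos hp0 (hpos _)) hIlow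
  have hI'up : I' ≤ (Real.exp (-(t * Real.exp (-ε))) + ε) * I := by
    rw [hI, ← integral_const_mul]
    refine setIntegral_mono_on_ae (hint _).integrableOn ((hint u).const_mul _).integrableOn hAm ?_
    filter_upwards [hptw] with y hy hyA using (hy hyA).1
  have hI'lo : (Real.exp (-(t * Real.exp (2*ε))) - ε) * I ≤ I' := by
    rw [hI, ← integral_const_mul]
    refine setIntegral_mono_on_ae ((hint u).const_mul _).integrableOn (hint _).integrableOn hAm ?_
    filter_upwards [hptw] with y hy hyA using (hy hyA).2
  have hsmall : F (u * Real.exp δ) ≤ ε * I := by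
    refine k2.trans ?_
    rw [mul_assoc]
    exact mul_le_mul_of_nonneg_left hIlow hε.le
  have hJs := (hJb u le_rfl).trans hsmall
  have hJ's := (hJb (u + a u * t) (by nlinarith)).trans hsmall
  have hc1 : Real.exp (-(t * Real.exp (2*ε))) ≤ 1 := by
    rw [Real.exp_le_one_iff]
    have := mul_nonneg ht (Real.exp_pos (2*ε)).le
    linarith
  have hc0 := Real.exp_pos (-(t * Real.exp (-ε)))
  rw [hH, hN]
  refine ⟨by linarith, ?_, ?_⟩
  · have := mul_nonneg (show 0 ≤ Real.exp (-(t * Real.exp (-ε))) + 2 * ε by linarith) hJ0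
    change I' + J' ≤ _
    have : J' ≤ ε * I := hJ's
    nlinarith
  · have : J ≤ ε * I := hJs
    nlinarith

theorem gumbel_random_contraction
    {Ω : Type*} [MeasureSpace Ω] [IsProbabilityMeasure (ℙ : Measure Ω)]
    (Y₁ Y₂ : Ω → ℝ) (hY₁ : Measurable Y₁) (hY₂ : Measurable Y₂)
    (hindep : IndepFun Y₁ Y₂)
    (hY₁pos : ∀ᵐ ω ∂ℙ, 0 < Y₁ ω)
    (hY₁end : ∀ u : ℝ, 0 < ℙ {ω | Y₁ ω > u})
    (hY₂pos : ∀ᵐ ω ∂ℙ, 0 < Y₂ ω) (hY₂le : ∀ᵐ ω ∂ℙ, Y₂ ω ≤ 1)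
    (hY₂end : ∀ w : ℝ, w < 1 → 0 < ℙ {ω | Y₂ ω > w})
    (a : ℝ → ℝ) (ha : ∀ u > 0, 0 < a u)
    (τ : ℝ) (hτ : -1 ≤ τ) (haRV : RegularlyVarying a (-τ))
    (hGum : ∀ t : ℝ, 0 ≤ t →
      Tendsto (fun u => (ℙ {ω | Y₁ ω > u + a u * t}).toReal / (ℙ {ω | Y₁ ω > u}).toReal)
        atTop (𝓝 (Real.exp (-t)))) :
    ∀ t : ℝ, 0 ≤ t →
      Tendsto (fun u =>
          (ℙ {ω | Y₁ ω * Y₂ ω > u + a u * t}).toReal / (ℙ {ω | Y₁ ω * Y₂ ω > u}).toReal)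
        atTop (𝓝 (Real.exp (-t))) := by
  intro t ht
  set μ₁ := Measure.map Y₁ (ℙ : Measure Ω) with hμ₁
  set G := Measure.map Y₂ (ℙ : Measure Ω) with hGdef
  haveI : IsProbabilityMeasure μ₁ := Measure.isProbabilityMeasure_map hY₁.aemeasurable
  haveI : IsProbabilityMeasure G := Measure.isProbabilityMeasure_map hY₂.aemeasurable
  let F : ℝ → ℝ := fun u => (ℙ {ω | Y₁ ω > u}).toReal
  have hFμ : ∀ u, F u = (μ₁ (Set.Ioi u)).toReal := fun u => by
    rw [hμ₁, Measure.map_apply hY₁ measurableSet_Ioi]; rfl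
  have hpos : ∀ u, 0 < F u := fun u => ENNReal.toReal_pos (hY₁end u).ne' (measure_ne_top _ _)
  have hF : Antitone F := by
    intro u v huv
    refine ENNReal.toReal_mono (measure_ne_top _ _) (measure_mono ?_)
    intro ω hω
    exact lt_of_le_of_lt huv hω
  have hF1 : ∀ u, F u ≤ 1 := fun u => measureReal_le_one
  have hF0 : Tendsto F atTop (𝓝 0) := by
    have h1 := (tendsto_cdf_atTop μ₁).const_sub 1
    rw [sub_self] at h1
    refine h1.congr fun u => ?_
    rw [hFμ, cdf_eq_real, ← Set.compl_Iic]
    exact (probReal_compl_eq_one_sub measurableSet_Iic).symm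
  have hG0 : ∀ᵐ y ∂G, 0 < y :=
    (ae_map_iff hY₂.aemeasurable measurableSet_Ioi).2 hY₂pos
  have hG1 : ∀ᵐ y ∂G, y ≤ 1 :=
    (ae_map_iff hY₂.aemeasurable measurableSet_Iic).2 hY₂le
  have hGend : ∀ w < 1, 0 < G (Set.Ioi w) := fun w hw => by
    rw [hGdef, Measure.map_apply hY₂ measurableSet_Ioi]
    exact hY₂end w hw
  have hprod : ∀ v : ℝ, (ℙ {ω | Y₁ ω * Y₂ ω > v}).toReal = ∫ y, F (v / y) ∂G := by
    intro v
    have hmap := (indepFun_iff_map_prod_eq_prod_map_map hY₁.aemeasurable hY₂.aemeasurable).1 hindep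
    have hms : MeasurableSet {q : ℝ × ℝ | q.1 * q.2 > v} :=
      measurableSet_lt measurable_const (measurable_fst.mul measurable_snd)
    have h1 : ℙ {ω | Y₁ ω * Y₂ ω > v} = (μ₁.prod G) {q : ℝ × ℝ | q.1 * q.2 > v} := by
      rw [← hmap, Measure.map_apply (hY₁.prodMk hY₂) hms]
      rfl
    rw [h1, Measure.prod_apply_symm hms]
    have h2 : ∫⁻ y, μ₁ ((fun x => (x, y)) ⁻¹' {q : ℝ × ℝ | q.1 * q.2 > v}) ∂G =
        ∫⁻ y, μ₁ (Set.Ioi (v / y)) ∂G := by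
      refine lintegral_congr_ae ?_
      filter_upwards [hG0] with y hy
      congr 1
      ext x
      simp [div_lt_iff₀ hy]
    have hmeas : Measurable fun y => F (v / y) :=
      hF.measurable.comp (measurable_const.div measurable_id)
    rw [h2, integral_eq_lintegral_of_nonneg_ae (Eventually.of_forall fun y => (hpos _).le)
      hmeas.aestronglyMeasurable]
    congr 1
    refine lintegral_congr fun y => ?_
    rw [hFμ, ENNReal.ofReal_toReal (measure_ne_top _ _)]
  simp only [hprod]
  have main := fun {ε : ℝ} (hε : 0 < ε) =>
    main_aux hpos hF hF1 hF0 ha hGum haRV G hG0 hG1 hGend t ht hε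
  have hU : Tendsto (fun ε : ℝ => Real.exp (-(t * Real.exp (-ε))) + 2 * ε) (𝓝[>] 0)
      (𝓝 (Real.exp (-t))) := by
    have hc : Continuous (fun ε : ℝ => Real.exp (-(t * Real.exp (-ε))) + 2 * ε) := by fun_prop
    have := hc.tendsto 0
    simp only [neg_zero, Real.exp_zero, mul_one, mul_zero, add_zero] at this
    exact this.mono_left nhdsWithin_le_nhds
  have hL : Tendsto (fun ε : ℝ => Real.exp (-(t * Real.exp (2 * ε))) - 2 * ε) (𝓝[>] 0)
      (𝓝 (Real.exp (-t))) := by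
    have hc : Continuous (fun ε : ℝ => Real.exp (-(t * Real.exp (2 * ε))) - 2 * ε) := by fun_prop
    have := hc.tendsto 0
    simp only [mul_zero, Real.exp_zero, mul_one, sub_zero] at this
    exact this.mono_left nhdsWithin_le_nhds
  rw [tendsto_order]
  constructor
  · intro r hr
    obtain ⟨ε, h1, h2⟩ := ((hL.eventually (lt_mem_nhds hr)).and self_mem_nhdsWithin).exists
    filter_upwards [main h2] with u hu
    refine lt_of_lt_of_le h1 ?_
    rw [le_div_iff₀ hu.1]
    exact hu.2.2
  · intro r hr
    obtain ⟨ε, h1, h2⟩ := ((hU.eventually (gt_mem_nhds hr)).and self_mem_nhdsWithin).exists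
    filter_upwards [main h2] with u hu
    refine lt_of_le_of_lt ?_ h1
    rw [div_le_iff₀ hu.1]
    exact hu.2.1
end

section
/- Let Y1, Y2 be independent positive random variables with P(Y_i > u) ∼ g_i(u) exp(-L_i u^{p_i}) as u → ∞, where g_1, g_2 are regularly varying at infinity and L_i, p_i > 0. Then with c_u = A u^{p1/(p1+p2)}, A = ((p1 L1)/(p2 L2))^{1/(p1+p2)}, B = L1 A^{-p1} + L2 A^{p2}, and D = (2π (p1L1)^{p2/(p1+p2)} (p2L2)^{p1/(p1+p2)}/(p1+p2))^{1/2}, one has P(Y1Y2 > u) ∼ D u^{p1p2/(2(p1+p2))} g1(u/c_u) g2(c_u) exp(-B u^{p1p2/(p1+p2)}) as u → ∞. -/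
open MeasureTheory ProbabilityTheory Filter Topology Real

lemma wp_uct_aux (h : ℝ → ℝ) (hm : Measurable h)
    (hs : ∀ s, Tendsto (fun t => h (t + s) - h t) atTop (𝓝 0)) (ε : ℝ) (hε : 0 < ε)
    (t : ℕ → ℝ) (ht : Tendsto t atTop atTop) :
    ∀ᶠ n in atTop, MeasurableSet {y ∈ Set.Icc (0:ℝ) 2 | ∀ m ≥ n, |h (t m + y) - h (t m)| ≤ ε} ∧
      ENNReal.ofReal (7/4) < volume {y ∈ Set.Icc (0:ℝ) 2 | ∀ m ≥ n, |h (t m + y) - h (t m)| ≤ ε} := by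
  set U : ℕ → Set ℝ := fun n => {y ∈ Set.Icc (0:ℝ) 2 | ∀ m ≥ n, |h (t m + y) - h (t m)| ≤ ε} with hU
  have hmono : Monotone U := by
    intro a b hab y hy
    exact ⟨hy.1, fun m hm => hy.2 m (le_trans hab hm)⟩
  have hun : ⋃ n, U n = Set.Icc 0 2 := by
    ext y
    simp only [Set.mem_iUnion]
    constructor
    · rintro ⟨n, hn⟩; exact hn.1
    · intro hy
      have h1 := (hs y).comp ht
      have h2 := (Metric.tendsto_nhds.1 h1 ε hε)
      obtain ⟨n, hn⟩ := eventually_atTop.1 h2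
      refine ⟨n, hy, fun m hm => ?_⟩
      have := hn m hm
      simp at this
      exact this.le
  have hlim := tendsto_measure_iUnion_atTop (μ := volume) hmono
  rw [hun, Real.volume_Icc] at hlim
  have hlt : ENNReal.ofReal (7/4) < ENNReal.ofReal (2 - 0) := by
    rw [ENNReal.ofReal_lt_ofReal_iff] <;> norm_num
  filter_upwards [hlim.eventually (lt_mem_nhds hlt)] with n hn
  refine ⟨?_, hn⟩
  have : {y ∈ Set.Icc (0:ℝ) 2 | ∀ m ≥ n, |h (t m + y) - h (t m)| ≤ ε} =
      Set.Icc 0 2 ∩ ⋂ m, ⋂ (_ : m ≥ n), {y | |h (t m + y) - h (t m)| ≤ ε} := by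
    ext y; simp
  rw [this]
  refine measurableSet_Icc.inter (MeasurableSet.iInter fun m => MeasurableSet.iInter fun _ => ?_)
  have h1 : Measurable fun y => |h (t m + y) - h (t m)| := by
    have := hm.comp (measurable_const_add (t m))
    exact (this.sub_const _).abs
  exact measurableSet_le h1 measurable_const

lemma wp_uct (h : ℝ → ℝ) (hm : Measurable h)
    (hs : ∀ s, Tendsto (fun t => h (t + s) - h t) atTop (𝓝 0)) (ε : ℝ) (hε : 0 < ε) :
    ∃ T, ∀ t ≥ T, ∀ s ∈ Set.Icc (0:ℝ) 1, |h (t + s) - h t| ≤ ε := by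
  by_contra! hcon
  choose t ht s hsI hbad using fun n : ℕ => hcon n
  have htt : Tendsto t atTop atTop := tendsto_atTop_mono ht tendsto_natCast_atTop_atTop
  have htt2 : Tendsto (fun n => t n + s n) atTop atTop :=
    tendsto_atTop_mono (fun n => by linarith [(hsI n).1]) htt
  obtain ⟨n, ⟨hUm, hU⟩, hVm, hV⟩ := ((wp_uct_aux h hm hs (ε/2) (by positivity) t htt).and
    (wp_uct_aux h hm hs (ε/2) (by positivity) _ htt2)).exists
  set U := {y ∈ Set.Icc (0:ℝ) 2 | ∀ m ≥ n, |h (t m + y) - h (t m)| ≤ ε/2}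
  set V := {y ∈ Set.Icc (0:ℝ) 2 | ∀ m ≥ n, |h (t m + s m + y) - h (t m + s m)| ≤ ε/2}
  have hV' : ENNReal.ofReal (7/4) < volume ((fun y => y - s n) ⁻¹' V) := by
    simpa only [sub_eq_add_neg, measure_preimage_add_right] using hV
  have hdisj : Disjoint U ((fun y => y - s n) ⁻¹' V) := by
    rw [Set.disjoint_left]
    intro y hy hy'
    have h1 := hy.2 n le_rfl
    have h2 := hy'.2 n le_rfl
    have h3 : t n + s n + (y - s n) = t n + y := by ring
    simp only [h3] at h2
    have h4 := hbad n
    have : |h (t n + s n) - h (t n)| ≤ ε := by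
      rw [abs_le] at *
      constructor <;> linarith
    linarith
  have hsub : U ∪ ((fun y => y - s n) ⁻¹' V) ⊆ Set.Icc 0 3 := by
    rintro y (hy | hy)
    · exact ⟨hy.1.1, by linarith [hy.1.2]⟩
    · have := hy.1; have h2 := hsI n
      simp only [Set.mem_Icc] at this h2 ⊢
      constructor <;> linarith
  have h1 := measure_mono (μ := volume) hsub
  rw [measure_union' hdisj hUm, Real.volume_Icc] at h1
  have h2 := (ENNReal.add_lt_add hU hV').trans_le h1
  rw [← ENNReal.ofReal_add (by norm_num) (by norm_num), ENNReal.ofReal_lt_ofReal_iff (by norm_num)] at h2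
  norm_num at h2

lemma wp_potter0 (h : ℝ → ℝ) (hm : Measurable h)
    (hs : ∀ s, Tendsto (fun t => h (t + s) - h t) atTop (𝓝 0)) (ε : ℝ) (hε : 0 < ε) :
    ∃ T, ∀ t ≥ T, ∀ t' ≥ T, |h t' - h t| ≤ ε * (1 + |t' - t|) := by
  obtain ⟨T, hT⟩ := wp_uct h hm hs ε hε
  have key : ∀ n : ℕ, ∀ t ≥ T, ∀ s ∈ Set.Icc (0:ℝ) 1, |h (t + (n + s)) - h t| ≤ ε * (1 + n) := by
    intro n
    induction n with
    | zero => intro t ht s hs; simpa using hT t ht s hs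
    | succ k ih =>
      intro t ht s hs
      have h1 := hT t ht 1 (by simp)
      have h2 := ih (t + 1) (by linarith) s hs
      have e : t + 1 + (k + s) = t + ((k + 1 : ℕ) + s) := by push_cast; ring
      rw [e] at h2
      push_cast at h2 ⊢
      rw [abs_le] at *
      constructor <;> linarith
  have key2 : ∀ t ≥ T, ∀ t' ≥ t, |h t' - h t| ≤ ε * (1 + |t' - t|) := by
    intro t ht t' ht'
    have h0 : 0 ≤ t' - t := by linarith
    have h1 := Nat.floor_le h0
    have h2 := Nat.lt_floor_add_one (t' - t)
    have := key ⌊t' - t⌋₊ t ht (t' - t - ⌊t' - t⌋₊) ⟨by linarith, by linarith⟩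
    rw [show t + ((⌊t' - t⌋₊:ℝ) + (t' - t - ⌊t' - t⌋₊)) = t' by ring] at this
    refine this.trans ?_
    rw [abs_of_nonneg h0]
    gcongr
  refine ⟨T, fun t ht t' ht' => ?_⟩
  rcases le_total t t' with hle | hle
  · exact key2 t ht t' hle
  · rw [abs_sub_comm, abs_sub_comm t']; exact key2 t' ht' t hle

/-- package of properties -/
structure WPTail (F : ℝ → ℝ) (L p ρ : ℝ) (G : ℝ → ℝ) : Prop where
  anti : Antitone F
  pos : ∀ u, 0 < F u
  le_one : ∀ u, F u ≤ 1
  Lpos : 0 < L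
  ppos : 0 < p
  hG : ∀ u, G u = F u * Real.exp (L * u ^ p)
  rv : ∀ x : ℝ, 0 < x → Tendsto (fun u => G (u * x) / G u) atTop (𝓝 (x ^ ρ))

lemma WPTail.Gpos {F G : ℝ → ℝ} {L p ρ : ℝ} (H : WPTail F L p ρ G) (u : ℝ) : 0 < G u := by
  rw [H.hG]; exact mul_pos (H.pos u) (exp_pos _)

lemma WPTail.measG {F G : ℝ → ℝ} {L p ρ : ℝ} (H : WPTail F L p ρ G) : Measurable G := by
  have : G = fun u => F u * Real.exp (L * u ^ p) := funext H.hG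
  rw [this]
  exact H.anti.measurable.mul (Real.measurable_exp.comp ((measurable_id.pow_const p).const_mul L))

lemma WPTail.potter {F G : ℝ → ℝ} {L p ρ : ℝ} (H : WPTail F L p ρ G) (ε : ℝ) (hε : 0 < ε) :
    ∃ T, ∀ t ≥ T, ∀ t' ≥ T,
      |log (G (exp t')) - log (G (exp t)) - ρ * (t' - t)| ≤ ε * (1 + |t' - t|) := by
  have := wp_potter0 (fun t => log (G (exp t)) - ρ * t) (by
    have h1 := Real.measurable_log.comp (H.measG.comp Real.measurable_exp)
    exact h1.sub (measurable_id.const_mul ρ)) (by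
    intro s
    have h1 := (H.rv (exp s) (exp_pos s)).comp tendsto_exp_atTop
    have h2 := (Real.continuousAt_log (Real.rpow_pos_of_pos (exp_pos s) ρ).ne').tendsto.comp h1
    have h3 := h2.sub_const (ρ * s)
    rw [Real.log_rpow (exp_pos s), Real.log_exp, sub_self] at h3
    refine h3.congr fun t => ?_
    simp only [Function.comp]
    rw [Real.log_div (H.Gpos _).ne' (H.Gpos _).ne', ← Real.exp_add]
    ring) ε hε
  obtain ⟨T, hT⟩ := this
  refine ⟨T, fun t ht t' ht' => ?_⟩
  have := hT t ht t' ht'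
  convert this using 2
  ring

lemma WPTail.loc {F G : ℝ → ℝ} {L p ρ : ℝ} (H : WPTail F L p ρ G) {α : Type*} {l : Filter α}
    (w v : α → ℝ) (hw : Tendsto w l atTop) (hv : Tendsto v l (𝓝 0)) :
    Tendsto (fun a => G (w a * exp (v a)) / G (w a)) l (𝓝 1) := by
  have h1 : Tendsto (fun a => log (G (w a * exp (v a))) - log (G (w a)) - ρ * v a) l (𝓝 0) := by
    rw [Metric.tendsto_nhds]
    intro ε hε
    obtain ⟨T, hT⟩ := H.potter (ε/3) (by positivity)
    filter_upwards [hw.eventually_ge_atTop (exp (T+1)), Metric.tendsto_nhds.1 hv 1 one_pos] with a ha hb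
    rw [Real.dist_eq, sub_zero] at hb ⊢
    have hwp : 0 < w a := (exp_pos _).trans_le ha
    have h2 : T + 1 ≤ log (w a) := by rwa [Real.le_log_iff_exp_le hwp]
    have hb' := abs_lt.1 hb
    have := hT (log (w a)) (by linarith) (log (w a) + v a) (by linarith)
    rw [Real.exp_add, Real.exp_log hwp, add_sub_cancel_left] at this
    nlinarith
  have h2 := h1.add (hv.const_mul ρ)
  have h3 := (Real.continuous_exp.tendsto _).comp h2
  simp only [mul_zero, add_zero, exp_zero] at h3
  refine h3.congr fun a => ?_
  simp only [Function.comp]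
  rw [sub_add_cancel, Real.exp_sub, Real.exp_log (H.Gpos _), Real.exp_log (H.Gpos _)]

lemma WPTail.bound {F G : ℝ → ℝ} {L p ρ : ℝ} (H : WPTail F L p ρ G) :
    ∃ C M w₀ : ℝ, 0 < C ∧ 0 < M ∧ 0 < w₀ ∧ ∀ w ≥ w₀, ∀ v,
      G (w * exp v) / G w ≤ C * exp (M * |v|) := by
  obtain ⟨T, hT⟩ := H.potter 1 one_pos
  set h := fun t => log (G (exp t)) with hh
  set K := max 1 (L * (exp T) ^ p - h T + 1)
  refine ⟨exp K, |ρ| + 1, exp T, exp_pos _, by positivity, exp_pos _, fun w hw v => ?_⟩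
  have hwp : 0 < w := (exp_pos _).trans_le hw
  have h2 : T ≤ log w := by rwa [Real.le_log_iff_exp_le hwp]
  rw [← Real.exp_add, ← Real.log_le_iff_le_exp (div_pos (H.Gpos _) (H.Gpos _)),
    Real.log_div (H.Gpos _).ne' (H.Gpos _).ne']
  have e1 : G (w * exp v) = G (exp (log w + v)) := by rw [Real.exp_add, Real.exp_log hwp]
  have e2 : G w = G (exp (log w)) := by rw [Real.exp_log hwp]
  rw [e1, e2]
  set t := log w
  by_cases hc : T ≤ t + v
  · have := hT t h2 (t + v) hc
    rw [add_sub_cancel_left] at this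
    have h3 := (abs_le.1 this).2
    have h4 : ρ * v ≤ |ρ| * |v| := by rw [← abs_mul]; exact le_abs_self _
    have : (1:ℝ) ≤ K := le_max_left _ _
    nlinarith
  · push Not at hc
    have h3 : log (G (exp (t + v))) ≤ L * (exp T) ^ p := by
      rw [Real.log_le_iff_le_exp (H.Gpos _), H.hG]
      calc _ ≤ 1 * exp (L * exp (t + v) ^ p) := by gcongr; exact H.le_one _
        _ ≤ _ := by
          rw [one_mul]; gcongr
          · exact H.Lpos.le
          · exact H.ppos.le
    have h4 := (abs_le.1 (hT T le_rfl t h2)).1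
    have h5 : t - T ≤ |v| := by have := neg_le_abs v; linarith
    rw [abs_of_nonneg (by linarith : 0 ≤ t - T)] at h4
    have h6 : -(ρ * (t - T)) ≤ |ρ| * |v| := by
      calc -(ρ * (t - T)) ≤ |ρ * (t-T)| := neg_le_abs _
        _ = |ρ| * (t - T) := by rw [abs_mul, abs_of_nonneg (by linarith : 0 ≤ t - T)]
        _ ≤ _ := by gcongr
    have : L * (exp T) ^ p - log (G (exp T)) + 1 ≤ K := le_max_right _ _
    linarith

lemma wp_exp_lim1 {α : Type*} {l : Filter α} (N : α → ℝ) (hN : Tendsto N l atTop) (x : ℝ) :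
    Tendsto (fun a => N a * (exp (x / N a) - 1)) l (𝓝 x) := by
  rw [tendsto_iff_norm_sub_tendsto_zero]
  have h0 : Tendsto (fun a => x ^ 2 / N a) l (𝓝 0) := hN.const_div_atTop _
  refine squeeze_zero' (Eventually.of_forall fun _ => norm_nonneg _) ?_ h0
  filter_upwards [hN.eventually_ge_atTop (|x| + 1)] with a ha
  have hNp : 0 < N a := by have := abs_nonneg x; linarith
  have h1 : |x / N a| ≤ 1 := by
    rw [abs_div, abs_of_pos hNp, div_le_one hNp]; linarith
  have h2 := Real.abs_exp_sub_one_sub_id_le h1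
  have h3 : N a * (exp (x / N a) - 1) - x = N a * (exp (x / N a) - 1 - x / N a) := by
    field_simp
  rw [h3, Real.norm_eq_abs, abs_mul, abs_of_pos hNp]
  calc _ ≤ N a * (x / N a) ^ 2 := by gcongr
    _ = _ := by field_simp

lemma wp_exp_lim2 {α : Type*} {l : Filter α} (r : α → ℝ) (hr : Tendsto r l atTop) (x : ℝ) :
    Tendsto (fun a => (r a) ^ 2 * (exp (x / r a) - 1 - x / r a)) l (𝓝 (x ^ 2 / 2)) := by
  rw [tendsto_iff_norm_sub_tendsto_zero]
  have h0 : Tendsto (fun a => |x| ^ 3 / r a) l (𝓝 0) := hr.const_div_atTop _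
  refine squeeze_zero' (Eventually.of_forall fun _ => norm_nonneg _) ?_ h0
  filter_upwards [hr.eventually_ge_atTop (|x| + 1)] with a ha
  have hNp : 0 < r a := by have := abs_nonneg x; linarith
  have h1 : |x / r a| ≤ 1 := by
    rw [abs_div, abs_of_pos hNp, div_le_one hNp]; linarith
  have h2 := Real.exp_bound h1 (n := 3) (by norm_num)
  norm_num [Finset.sum_range_succ, Nat.factorial] at h2
  have h3 : (r a) ^ 2 * (exp (x / r a) - 1 - x / r a) - x ^ 2 / 2 =
      (r a) ^ 2 * (exp (x / r a) - (1 + x / r a + (x / r a) ^ 2 / 2)) := by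
    field_simp
    ring
  rw [h3, Real.norm_eq_abs, abs_mul, abs_of_pos (pow_pos hNp 2)]
  calc _ ≤ (r a) ^ 2 * (|x| / r a) ^ 3 := by
        gcongr
        refine h2.trans ?_
        rw [abs_div, abs_of_pos hNp, div_pow]
        have : 0 ≤ |x| ^ 3 / r a ^ 3 := by positivity
        linarith
    _ = _ := by field_simp

lemma WPTail.F_eq {F G : ℝ → ℝ} {L p ρ : ℝ} (H : WPTail F L p ρ G) (u : ℝ) :
    F u = G u * exp (-(L * u ^ p)) := by
  rw [H.hG, mul_assoc, ← Real.exp_add]; simp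

lemma wp_image (y N : ℝ) (hy : 0 < y) (hN : 0 < N) :
    (fun t => y * exp (t / N)) '' (Set.Ioi 0) = Set.Ioi y := by
  ext z
  constructor
  · rintro ⟨t, ht, rfl⟩
    have ht : 0 < t := ht
    have : 1 < exp (t / N) := Real.one_lt_exp_iff.2 (by positivity)
    show y < _
    nlinarith
  · intro hz
    have hz : y < z := hz
    have hz0 : 0 < z := hy.trans hz
    refine ⟨N * log (z / y), ?_, ?_⟩
    · exact mul_pos hN (Real.log_pos ((one_lt_div hy).2 hz))
    · simp only []
      rw [mul_div_cancel_left₀ _ hN.ne', Real.exp_log (by positivity)]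
      field_simp

lemma wp_image_univ (y N : ℝ) (hy : 0 < y) (hN : 0 < N) :
    (fun t => y * exp (t / N)) '' Set.univ = Set.Ioi 0 := by
  ext z
  constructor
  · rintro ⟨t, ht, rfl⟩
    exact mul_pos hy (exp_pos _)
  · intro hz
    have hz0 : 0 < z := hz
    refine ⟨N * log (z / y), trivial, ?_⟩
    simp only []
    rw [mul_div_cancel_left₀ _ hN.ne', Real.exp_log (by positivity)]
    field_simp

lemma wp_deriv (y N t : ℝ) :
    HasDerivAt (fun t => y * exp (t / N)) (y * exp (t / N) / N) t := by
  have := ((hasDerivAt_id t).div_const N).exp.const_mul y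
  have e : y * exp (t / N) / N = y * (exp (t / N) * (1 / N)) := by ring
  rw [e]
  exact this

lemma wp_inj (y N : ℝ) (hy : 0 < y) (hN : 0 < N) :
    Function.Injective (fun t => y * exp (t / N)) := by
  intro t s h
  have h := mul_left_cancel₀ hy.ne' h
  have h := Real.exp_injective h
  field_simp at h
  exact h

lemma WPTail.S_eq {F G : ℝ → ℝ} {L p ρ : ℝ} (H : WPTail F L p ρ G) (y : ℝ) (hy : 0 < y) :
    ∫⁻ z in Set.Ioi y, ENNReal.ofReal (p * L * z ^ (p - 1) * F z) =
    ENNReal.ofReal (F y) * ∫⁻ t in Set.Ioi 0, ENNReal.ofReal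
      (p * (G (y * exp (t / (L * y ^ p))) / G y) * exp (p * (t / (L * y ^ p))) *
        exp (-((L * y ^ p) * (exp (p * t / (L * y ^ p)) - 1)))) := by
  have hL := H.Lpos
  have hp := H.ppos
  have hN : 0 < L * y ^ p := by positivity
  rw [← wp_image y (L * y ^ p) hy hN,
    lintegral_image_eq_lintegral_abs_deriv_mul measurableSet_Ioi
      (fun t _ => (wp_deriv y (L * y ^ p) t).hasDerivWithinAt) (wp_inj y _ hy hN).injOn,
    ← lintegral_const_mul' _ _ ENNReal.ofReal_ne_top]
  refine lintegral_congr fun t => ?_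
  rw [← ENNReal.ofReal_mul (abs_nonneg _), ← ENNReal.ofReal_mul (H.pos _).le]
  congr 1
  rw [abs_of_pos (by positivity)]
  have hG := H.Gpos y
  rw [H.F_eq y, H.F_eq (y * _)]
  set N := L * y ^ p with hNd
  have e1 : (y * exp (t / N)) ^ (p - 1) = y ^ p / y * exp (p * (t / N)) / exp (t / N) := by
    rw [Real.mul_rpow hy.le (exp_pos _).le, Real.rpow_sub_one hy.ne', ← Real.exp_mul,
      mul_sub, mul_one, Real.exp_sub, mul_comm (t / N)]
    ring
  have e2 : L * (y * exp (t / N)) ^ p = N * exp (p * t / N) := by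
    rw [Real.mul_rpow hy.le (exp_pos _).le, ← Real.exp_mul, hNd]
    rw [show t / (L * y ^ p) * p = p * t / (L * y ^ p) by ring]
    ring
  have e3 : exp (-(N * (exp (p * t / N) - 1))) = exp (-(N * exp (p * t / N))) / exp (-N) := by
    rw [← Real.exp_sub]; congr 1; ring
  rw [e1, e2, e3]
  have hyp : 0 < y ^ p := by positivity
  field_simp
  rw [hNd]

lemma WPTail.S_lim {F G : ℝ → ℝ} {L p ρ : ℝ} (H : WPTail F L p ρ G) :
    Tendsto (fun y => (∫⁻ z in Set.Ioi y, ENNReal.ofReal (p * L * z ^ (p - 1) * F z)) /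
      ENNReal.ofReal (F y)) atTop (𝓝 1) := by
  have hL := H.Lpos
  have hp := H.ppos
  obtain ⟨C, M, w₀, hC, hM, hw₀, hbd⟩ := H.bound
  have hNt : Tendsto (fun y : ℝ => L * y ^ p) atTop atTop :=
    (tendsto_rpow_atTop hp).const_mul_atTop hL
  have hIntEq : ∫⁻ t in Set.Ioi (0:ℝ), ENNReal.ofReal (p * exp (-(p * t))) = 1 := by
    rw [← ofReal_integral_eq_lintegral_ofReal]
    · rw [integral_const_mul]
      have := integral_exp_mul_Ioi (a := -p) (by linarith) 0
      simp only [neg_mul] at this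
      rw [this]
      simp
      field_simp
    · have := integrableOn_exp_mul_Ioi (a := -p) (by linarith) 0
      simp only [neg_mul] at this
      exact this.const_mul p
    · exact Eventually.of_forall fun t => by positivity
  have key : Tendsto (fun y => ∫⁻ t in Set.Ioi 0, ENNReal.ofReal
      (p * (G (y * exp (t / (L * y ^ p))) / G y) * exp (p * (t / (L * y ^ p))) *
        exp (-((L * y ^ p) * (exp (p * t / (L * y ^ p)) - 1))))) atTop (𝓝 1) := by
    rw [← hIntEq]
    refine tendsto_lintegral_filter_of_dominated_convergence
      (fun t => ENNReal.ofReal (p * C * exp (-(p / 2) * t))) ?_ ?_ ?_ ?_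
    · refine Eventually.of_forall fun y => ?_
      have := H.measG
      fun_prop
    · filter_upwards [hNt.eventually_ge_atTop (2 * (M + p) / p), eventually_ge_atTop w₀] with y hy hy2
      refine (ae_restrict_iff' measurableSet_Ioi).2 (Eventually.of_forall fun t ht => ?_)
      have ht : 0 < t := ht
      have hy0 : 0 < y := hw₀.trans_le hy2
      set N := L * y ^ p with hNd
      have hN : 0 < N := by positivity
      refine ENNReal.ofReal_le_ofReal ?_
      have b1 := hbd y hy2 (t / N)
      rw [abs_of_pos (by positivity)] at b1
      have b2 : p * t ≤ N * (exp (p * t / N) - 1) := by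
        have := Real.add_one_le_exp (p * t / N)
        calc p * t = N * (p * t / N) := by field_simp
          _ ≤ _ := by gcongr; linarith
      calc _ ≤ p * (C * exp (M * (t / N))) * exp (p * (t / N)) * exp (-(p * t)) := by
            gcongr
        _ = p * C * exp (M * (t / N) + p * (t / N) + -(p * t)) := by
            rw [Real.exp_add, Real.exp_add]; ring
        _ ≤ _ := by
            gcongr
            have : (M + p) * (t / N) ≤ p / 2 * t := by
              rw [div_le_iff₀ hp] at hy
              rw [← mul_div_assoc, div_le_iff₀ hN]
              nlinarith
            linarith
    · have := (integrableOn_exp_mul_Ioi (a := -(p/2)) (by linarith) 0).const_mul (p * C)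
      have h2 := this.lintegral_lt_top
      exact h2.ne
    · refine Eventually.of_forall fun t => ?_
      refine ENNReal.tendsto_ofReal ?_
      have hv : Tendsto (fun y => t / (L * y ^ p)) atTop (𝓝 0) := hNt.const_div_atTop t
      have l1 := H.loc (fun y => y) _ tendsto_id hv
      have l2 := (Real.continuous_exp.tendsto _).comp (hv.const_mul p)
      have l3 := (Real.continuous_exp.tendsto _).comp (wp_exp_lim1 _ hNt (p * t)).neg
      have := ((l1.const_mul p).mul l2).mul l3
      simpa [Function.comp_def] using this
  refine key.congr' ?_
  filter_upwards [eventually_gt_atTop 0] with y hy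
  rw [H.S_eq y hy, mul_comm (ENNReal.ofReal (F y)), ENNReal.mul_div_cancel_right]
  · simpa using H.pos y
  · exact ENNReal.ofReal_ne_top

lemma wp_Q_eq {F₁ G₁ F₂ G₂ : ℝ → ℝ} {L₁ p₁ ρ₁ L₂ p₂ ρ₂ : ℝ} (H₁ : WPTail F₁ L₁ p₁ ρ₁ G₁)
    (H₂ : WPTail F₂ L₂ p₂ ρ₂ G₂) (a b w c r : ℝ) (hw : 0 < w) (hc : 0 < c) (hr : 0 < r)
    (h1 : L₁ * w ^ p₁ = a * r ^ 2) (h2 : L₂ * c ^ p₂ = b * r ^ 2) :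
    ∫⁻ y in Set.Ioi 0, ENNReal.ofReal (F₁ (w * c / y) * (p₂ * L₂ * y ^ (p₂ - 1) * F₂ y)) =
    ENNReal.ofReal (p₂ * b * (r * G₁ w * G₂ c * exp (-((a + b) * r ^ 2)))) *
      ∫⁻ t, ENNReal.ofReal
        ((G₁ (w * exp (-(t / r))) / G₁ w) * (G₂ (c * exp (t / r)) / G₂ c) * exp (p₂ * (t / r)) *
          exp (-(r ^ 2 * (a * (exp (-p₁ * t / r) - 1) + b * (exp (p₂ * t / r) - 1))))) := by
  have hL := H₂.Lpos
  have hp := H₂.ppos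
  have hb : 0 < b := by
    have : 0 < b * r ^ 2 := by rw [← h2]; positivity
    exact pos_of_mul_pos_left this (by positivity)
  have hg1 := H₁.Gpos w
  have hg2 := H₂.Gpos c
  rw [← wp_image_univ c r hc hr,
    lintegral_image_eq_lintegral_abs_deriv_mul MeasurableSet.univ
      (fun t _ => (wp_deriv c r t).hasDerivWithinAt) (wp_inj c _ hc hr).injOn,
    ← lintegral_const_mul' _ _ ENNReal.ofReal_ne_top, Measure.restrict_univ]
  refine lintegral_congr fun t => ?_
  rw [← ENNReal.ofReal_mul (abs_nonneg _), ← ENNReal.ofReal_mul (by positivity)]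
  congr 1
  rw [abs_of_pos (by positivity)]
  have e0 : w * c / (c * exp (t / r)) = w * exp (-(t / r)) := by
    rw [Real.exp_neg]; field_simp
  rw [e0, H₁.F_eq (w * _), H₂.F_eq (c * _)]
  have e1 : (c * exp (t / r)) ^ (p₂ - 1) = c ^ p₂ / c * exp (p₂ * (t / r)) / exp (t / r) := by
    rw [Real.mul_rpow hc.le (exp_pos _).le, Real.rpow_sub_one hc.ne', ← Real.exp_mul,
      mul_sub, mul_one, Real.exp_sub, mul_comm (t / r)]
    ring
  have e2 : L₂ * (c * exp (t / r)) ^ p₂ = b * r ^ 2 * exp (p₂ * t / r) := by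
    rw [Real.mul_rpow hc.le (exp_pos _).le, ← Real.exp_mul, ← h2,
      show t / r * p₂ = p₂ * t / r by ring]
    ring
  have e3 : L₁ * (w * exp (-(t / r))) ^ p₁ = a * r ^ 2 * exp (-p₁ * t / r) := by
    rw [Real.mul_rpow hw.le (exp_pos _).le, ← Real.exp_mul, ← h1,
      show -(t / r) * p₁ = -p₁ * t / r by ring]
    ring
  have e4 : exp (-(r ^ 2 * (a * (exp (-p₁ * t / r) - 1) + b * (exp (p₂ * t / r) - 1)))) =
      exp (-(a * r ^ 2 * exp (-p₁ * t / r))) * exp (-(b * r ^ 2 * exp (p₂ * t / r))) /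
        exp (-((a + b) * r ^ 2)) := by
    rw [← Real.exp_add, ← Real.exp_sub]; congr 1; ring
  have e5 : L₂ = b * r ^ 2 / c ^ p₂ := by rw [← h2]; field_simp
  rw [e1, e2, e3, e4, e5]
  have hyp : 0 < c ^ p₂ := by positivity
  field_simp

lemma wp_quad (p₁ p₂ a b : ℝ) (hp₁ : 0 < p₁) (hp₂ : 0 < p₂) (ha : 0 < a) (hb : 0 < b)
    (hab : p₁ * a = p₂ * b) (v : ℝ) :
    min (a * p₁ ^ 2 / 2) (b * p₂ ^ 2 / 2) * v ^ 2 ≤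
      a * (exp (-p₁ * v) - 1) + b * (exp (p₂ * v) - 1) := by
  have e1 := Real.add_one_le_exp (-p₁ * v)
  have e2 := Real.add_one_le_exp (p₂ * v)
  rcases le_total 0 v with hv | hv
  · have e3 := Real.quadratic_le_exp_of_nonneg (x := p₂ * v) (by positivity)
    have m1 := mul_le_mul_of_nonneg_left e1 ha.le
    have m2 := mul_le_mul_of_nonneg_left e3 hb.le
    have m3 := mul_le_mul_of_nonneg_right (min_le_right (a * p₁ ^ 2 / 2) (b * p₂ ^ 2 / 2)) (sq_nonneg v)
    have : p₁ * a * v = p₂ * b * v := by rw [hab]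
    nlinarith
  · have e3 := Real.quadratic_le_exp_of_nonneg (x := -p₁ * v) (by nlinarith)
    have m1 := mul_le_mul_of_nonneg_left e3 ha.le
    have m2 := mul_le_mul_of_nonneg_left e2 hb.le
    have m3 := mul_le_mul_of_nonneg_right (min_le_left (a * p₁ ^ 2 / 2) (b * p₂ ^ 2 / 2)) (sq_nonneg v)
    have : p₁ * a * v = p₂ * b * v := by rw [hab]
    nlinarith

lemma wp_int_bound (K κ : ℝ) (hκ : 0 < κ) : Integrable (fun t : ℝ => exp (K * |t| - κ * t ^ 2)) := by
  have h := (integrable_exp_neg_mul_sq (b := κ / 2) (by positivity)).const_mul (exp (K ^ 2 / (2 * κ)))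
  refine h.mono' (by fun_prop) (Eventually.of_forall fun t => ?_)
  rw [Real.norm_eq_abs, abs_of_pos (exp_pos _), ← Real.exp_add]
  gcongr
  have h1 : 0 ≤ (K - κ * |t|) ^ 2 / (2 * κ) := by positivity
  have h2 : (K - κ * |t|) ^ 2 / (2 * κ) = K ^ 2 / (2 * κ) - K * |t| + κ / 2 * |t| ^ 2 := by
    field_simp
    ring
  rw [sq_abs] at h2
  linarith

lemma wp_Q_lim {F₁ G₁ F₂ G₂ : ℝ → ℝ} {L₁ p₁ ρ₁ L₂ p₂ ρ₂ : ℝ} (H₁ : WPTail F₁ L₁ p₁ ρ₁ G₁)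
    (H₂ : WPTail F₂ L₂ p₂ ρ₂ G₂) (a b : ℝ) (ha : 0 < a) (hb : 0 < b) (hab : p₁ * a = p₂ * b)
    (w c r : ℝ → ℝ) (hw : Tendsto w atTop atTop) (hc : Tendsto c atTop atTop)
    (hr : Tendsto r atTop atTop) :
    Tendsto (fun u => ∫⁻ t, ENNReal.ofReal
        ((G₁ (w u * exp (-(t / r u))) / G₁ (w u)) * (G₂ (c u * exp (t / r u)) / G₂ (c u)) *
          exp (p₂ * (t / r u)) * exp (-(r u ^ 2 * (a * (exp (-p₁ * t / r u) - 1) +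
            b * (exp (p₂ * t / r u) - 1)))))) atTop
      (𝓝 (ENNReal.ofReal (√(2 * π / (p₂ * b * (p₁ + p₂)))))) := by
  have hp₁ := H₁.ppos
  have hp₂ := H₂.ppos
  obtain ⟨C₁, M₁, w₁, hC₁, hM₁, hw₁, hbd₁⟩ := H₁.bound
  obtain ⟨C₂, M₂, w₂, hC₂, hM₂, hw₂, hbd₂⟩ := H₂.bound
  set κ := min (a * p₁ ^ 2 / 2) (b * p₂ ^ 2 / 2) with hκd
  have hκ : 0 < κ := by rw [hκd]; positivity
  have hIntEq : ∫⁻ t : ℝ, ENNReal.ofReal (exp (-(p₂ * b * (p₁ + p₂) / 2) * t ^ 2)) =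
      ENNReal.ofReal (√(2 * π / (p₂ * b * (p₁ + p₂)))) := by
    rw [← ofReal_integral_eq_lintegral_ofReal]
    · rw [integral_gaussian]
      congr 2
      field_simp
    · exact integrable_exp_neg_mul_sq (by positivity)
    · exact Eventually.of_forall fun t => by positivity
  rw [← hIntEq]
  refine tendsto_lintegral_filter_of_dominated_convergence
      (fun t => ENNReal.ofReal (C₁ * C₂ * exp ((M₁ + M₂ + p₂) * |t| - κ * t ^ 2))) ?_ ?_ ?_ ?_
  · refine Eventually.of_forall fun y => ?_
    have := H₁.measG
    have := H₂.measG
    fun_prop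
  · filter_upwards [hr.eventually_ge_atTop 1, hw.eventually_ge_atTop w₁,
      hc.eventually_ge_atTop w₂] with u hu hu1 hu2
    refine Eventually.of_forall fun t => ENNReal.ofReal_le_ofReal ?_
    have hr0 : 0 < r u := by linarith
    have hg1 := H₁.Gpos
    have hg2 := H₂.Gpos
    have b1 := hbd₁ _ hu1 (-(t / r u))
    have b2 := hbd₂ _ hu2 (t / r u)
    have hle : |t / r u| ≤ |t| := by
      rw [abs_div, abs_of_pos hr0]; exact div_le_self (abs_nonneg _) hu
    rw [abs_neg] at b1
    have b3 := wp_quad p₁ p₂ a b hp₁ hp₂ ha hb hab (t / r u)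
    rw [← hκd] at b3
    have b4 : κ * t ^ 2 ≤ r u ^ 2 * (a * (exp (-p₁ * t / r u) - 1) +
            b * (exp (p₂ * t / r u) - 1)) := by
      rw [mul_div_assoc, mul_div_assoc]
      calc κ * t ^ 2 = r u ^ 2 * (κ * (t / r u) ^ 2) := by field_simp
        _ ≤ _ := by gcongr
    have b5 : t / r u ≤ |t| := (le_abs_self _).trans hle
    calc _ ≤ (C₁ * exp (M₁ * |t|)) * (C₂ * exp (M₂ * |t|)) * exp (p₂ * |t|) * exp (-(κ * t ^ 2)) := by
          have q1 : 0 ≤ G₂ (c u * exp (t / r u)) / G₂ (c u) := (div_pos (hg2 _) (hg2 _)).le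
          gcongr
          · exact b1.trans (by gcongr)
          · exact b2.trans (by gcongr)
      _ = _ := by
          rw [show (M₁ + M₂ + p₂) * |t| - κ * t ^ 2 = M₁ * |t| + M₂ * |t| + p₂ * |t| + -(κ * t ^ 2) by ring,
            Real.exp_add, Real.exp_add, Real.exp_add]
          ring
  · exact ((wp_int_bound (M₁ + M₂ + p₂) κ hκ).const_mul (C₁ * C₂)).lintegral_lt_top.ne
  · refine Eventually.of_forall fun t => ENNReal.tendsto_ofReal ?_
    have hv : Tendsto (fun u => t / r u) atTop (𝓝 0) := hr.const_div_atTop t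
    have hv' : Tendsto (fun u => -(t / r u)) atTop (𝓝 0) := by simpa using hv.neg
    have l1 := H₁.loc w _ hw hv'
    have l2 := H₂.loc c _ hc hv
    have l3 := (Real.continuous_exp.tendsto _).comp (hv.const_mul p₂)
    have l4 := ((wp_exp_lim2 r hr (-p₁ * t)).const_mul a).add ((wp_exp_lim2 r hr (p₂ * t)).const_mul b)
    have l5 : Tendsto (fun u => r u ^ 2 * (a * (exp (-p₁ * t / r u) - 1) +
            b * (exp (p₂ * t / r u) - 1))) atTop (𝓝 (p₂ * b * (p₁ + p₂) / 2 * t ^ 2)) := by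
      have e : p₂ * b * (p₁ + p₂) / 2 * t ^ 2 = a * ((-p₁ * t) ^ 2 / 2) + b * ((p₂ * t) ^ 2 / 2) := by
        have : p₁ * (p₁ * a) * t ^ 2 = p₁ * (p₂ * b) * t ^ 2 := by rw [hab]
        linarith
      rw [e]
      refine l4.congr fun u => ?_
      have : p₁ * a * t / r u = p₂ * b * t / r u := by rw [hab]
      have e2 : a * (-p₁ * t / r u) + b * (p₂ * t / r u) = 0 := by
        calc _ = -(p₁ * a * t / r u) + p₂ * b * t / r u := by ring
          _ = 0 := by rw [this]; ring
      linear_combination (-(r u ^ 2)) * e2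
    have l6 := (Real.continuous_exp.tendsto _).comp l5.neg
    have := ((l1.mul l2).mul l3).mul l6
    simpa [Function.comp_def] using this

lemma WPTail.mk' {F g : ℝ → ℝ} {L p ρ : ℝ} (hL : 0 < L) (hp : 0 < p) (hanti : Antitone F)
    (h0 : ∀ u, 0 ≤ F u) (h1 : ∀ u, F u ≤ 1) (hg : ∀ u > 0, 0 < g u)
    (hrv : ∀ x : ℝ, 0 < x → Tendsto (fun u => g (u * x) / g u) atTop (𝓝 (x ^ ρ)))
    (h : Tendsto (fun u => F u / (g u * Real.exp (-(L * u ^ p)))) atTop (𝓝 1)) :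
    WPTail F L p ρ (fun u => F u * Real.exp (L * u ^ p)) ∧
    Tendsto (fun u => (F u * Real.exp (L * u ^ p)) / g u) atTop (𝓝 1) := by
  have hG : Tendsto (fun u => (F u * Real.exp (L * u ^ p)) / g u) atTop (𝓝 1) := by
    refine h.congr fun u => ?_
    rw [Real.exp_neg]
    by_cases hgu : g u = 0
    · simp [hgu]
    · field_simp
  refine ⟨⟨hanti, ?_, h1, hL, hp, fun _ => rfl, ?_⟩, hG⟩
  · intro u
    have h2 := h.eventually (lt_mem_nhds (show (0:ℝ) < 1 from one_pos))
    obtain ⟨v, hv, hvu⟩ := (h2.and (eventually_ge_atTop u)).exists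
    have : F v ≠ 0 := by
      intro h; simp [h] at hv
    have h3 := lt_of_le_of_ne (h0 v) (Ne.symm this)
    exact h3.trans_le (hanti hvu)
  · intro x hx
    have a1 : Tendsto (fun u : ℝ => u * x) atTop atTop := tendsto_id.atTop_mul_const hx
    have a2 := ((hG.comp a1).mul (hrv x hx)).mul (hG.inv₀ one_ne_zero)
    simp only [one_mul, inv_one, mul_one] at a2
    refine a2.congr' ?_
    filter_upwards [eventually_gt_atTop 0] with u hu
    have b1 := hg u hu
    have b2 := hg (u * x) (by positivity)
    simp only [Function.comp]
    field_simp

lemma WPTail.f_meas {F G : ℝ → ℝ} {L p ρ : ℝ} (H : WPTail F L p ρ G) :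
    Measurable (fun z => ENNReal.ofReal (p * L * z ^ (p - 1) * F z)) := by
  have := H.anti.measurable
  fun_prop

lemma WPTail.S_bounds {F G : ℝ → ℝ} {L p ρ : ℝ} (H : WPTail F L p ρ G) (δ : ℝ) (hδ : 0 < δ) :
    ∃ y₀ > 0, ∀ y ≥ y₀,
      (∫⁻ z in Set.Ioi y, ENNReal.ofReal (p * L * z ^ (p - 1) * F z)) ≤
        ENNReal.ofReal (1 + δ) * ENNReal.ofReal (F y) ∧
      ENNReal.ofReal (F y) ≤ ENNReal.ofReal (1 + δ) *
        (∫⁻ z in Set.Ioi y, ENNReal.ofReal (p * L * z ^ (p - 1) * F z)) := by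
  have h1 : (1 : ENNReal) < ENNReal.ofReal (1 + δ) := by
    rw [← ENNReal.ofReal_one, ENNReal.ofReal_lt_ofReal_iff (by linarith)]; linarith
  have h2 : (ENNReal.ofReal (1 + δ))⁻¹ < 1 := by
    rwa [ENNReal.inv_lt_one]
  obtain ⟨y, hy⟩ := eventually_atTop.1 ((H.S_lim.eventually (gt_mem_nhds h1)).and
    (H.S_lim.eventually (lt_mem_nhds h2)))
  refine ⟨max y 1, by positivity, fun z hz => ?_⟩
  obtain ⟨k1, k2⟩ := hy z (le_of_max_le_left hz)
  have hF : ENNReal.ofReal (F z) ≠ 0 := by simpa using H.pos z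
  have hF' : ENNReal.ofReal (F z) ≠ ⊤ := ENNReal.ofReal_ne_top
  constructor
  · exact (ENNReal.div_le_iff hF hF').1 k1.le
  · have := (ENNReal.le_div_iff_mul_le (Or.inl hF) (Or.inl hF')).1 k2.le
    rw [← ENNReal.div_eq_inv_mul, ENNReal.div_le_iff (by simp; linarith) ENNReal.ofReal_ne_top] at this
    rwa [mul_comm]

lemma WPTail.S_zero {F G : ℝ → ℝ} {L p ρ : ℝ} (H : WPTail F L p ρ G) :
    (∫⁻ z in Set.Ioi 0, ENNReal.ofReal (p * L * z ^ (p - 1) * F z)) < ⊤ := by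
  have hL := H.Lpos
  have hp := H.ppos
  obtain ⟨y, hy, hy'⟩ := H.S_bounds 1 one_pos
  rw [← Set.Ioc_union_Ioi_eq_Ioi hy.le]
  refine (lintegral_union_le _ _ _).trans_lt (ENNReal.add_lt_top.2 ⟨?_, ?_⟩)
  · have h1 : IntegrableOn (fun z : ℝ => z ^ (p - 1)) (Set.Ioc 0 y) := by
      rw [← intervalIntegrable_iff_integrableOn_Ioc_of_le hy.le]
      exact intervalIntegral.intervalIntegrable_rpow' (by linarith)
    refine lt_of_le_of_lt ?_ (h1.const_mul (p * L)).lintegral_lt_top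
    refine setLIntegral_mono' measurableSet_Ioc fun z hz => ENNReal.ofReal_le_ofReal ?_
    have := hz.1
    exact mul_le_of_le_one_right (by positivity) (H.le_one z)
  · exact (hy' y le_rfl).1.trans_lt (ENNReal.mul_lt_top ENNReal.ofReal_lt_top ENNReal.ofReal_lt_top)

lemma WPTail.ratio {F G : ℝ → ℝ} {L p ρ : ℝ} (H : WPTail F L p ρ G) (x : ℝ) (hx : 1 < x) :
    Tendsto (fun u => F (u * x) / F u) atTop (𝓝 0) := by
  have hL := H.Lpos
  have hp := H.ppos
  have h1 := H.rv x (by linarith)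
  have hx1 : 1 < x ^ p := Real.one_lt_rpow hx hp
  have h2 : Tendsto (fun u : ℝ => -(L * (x ^ p - 1) * u ^ p)) atTop atBot :=
    tendsto_neg_atTop_atBot.comp
      ((tendsto_rpow_atTop hp).const_mul_atTop (mul_pos hL (by linarith)))
  have h3 := h1.mul (Real.tendsto_exp_atBot.comp h2)
  rw [mul_zero] at h3
  refine h3.congr' ?_
  filter_upwards [eventually_gt_atTop 0] with u hu
  have g1 := H.Gpos u
  rw [H.F_eq, H.F_eq u, mul_div_mul_comm]
  simp only [Function.comp]
  rw [← Real.exp_sub, Real.mul_rpow hu.le (by linarith)]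
  congr 2
  ring

lemma wp_small {F₁ G₁ F₂ G₂ : ℝ → ℝ} {L₁ p₁ ρ₁ L₂ p₂ ρ₂ : ℝ} (H₁ : WPTail F₁ L₁ p₁ ρ₁ G₁)
    (H₂ : WPTail F₂ L₂ p₂ ρ₂ G₂) (y₀ : ℝ) (hy₀ : 0 < y₀) (ε : ℝ) (hε : 0 < ε) :
    ∀ᶠ u in atTop, ENNReal.ofReal (F₁ (u / y₀)) ≤ ENNReal.ofReal ε *
      ∫⁻ y in Set.Ioi 0, ENNReal.ofReal (F₁ (u / y) * (p₂ * L₂ * y ^ (p₂ - 1) * F₂ y)) := by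
  have hL := H₂.Lpos
  have hp := H₂.ppos
  set k := ∫⁻ y in Set.Ioc (y₀ + 1) (y₀ + 2), ENNReal.ofReal (p₂ * L₂ * y ^ (p₂ - 1) * F₂ y) with hk
  have hkpos : 0 < k := by
    rw [hk, setLIntegral_pos_iff H₂.f_meas]
    have : Set.Ioc (y₀ + 1) (y₀ + 2) ⊆ (Function.support fun y => ENNReal.ofReal (p₂ * L₂ * y ^ (p₂ - 1) * F₂ y)) ∩ Set.Ioc (y₀ + 1) (y₀ + 2) := by
      intro y hy
      refine ⟨?_, hy⟩
      have hy1 : 0 < y := by linarith [hy.1]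
      have := H₂.pos y
      simp only [Function.mem_support, ne_eq, ENNReal.ofReal_eq_zero, not_le]
      positivity
    refine lt_of_lt_of_le ?_ (measure_mono this)
    rw [Real.volume_Ioc]; simp
  have hεk : 0 < ENNReal.ofReal ε * k := by
    refine ENNReal.mul_pos ?_ hkpos.ne'
    simpa using hε
  obtain ⟨η, hη, hηk⟩ := ENNReal.lt_iff_exists_nnreal_btwn.1 hεk
  have hη : (0:ℝ) < η := by exact_mod_cast hη
  have ht : Tendsto (fun u : ℝ => u / (y₀ + 1)) atTop atTop := tendsto_id.atTop_div_const (by positivity)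
  have hlim := (H₁.ratio ((y₀ + 1) / y₀) (by rw [one_lt_div hy₀]; linarith)).comp ht
  filter_upwards [hlim.eventually (gt_mem_nhds hη), eventually_gt_atTop 0] with u hu hu0
  simp only [Function.comp] at hu
  rw [show u / (y₀ + 1) * ((y₀ + 1) / y₀) = u / y₀ by field_simp, div_lt_iff₀ (H₁.pos _)] at hu
  calc ENNReal.ofReal (F₁ (u / y₀)) ≤ ENNReal.ofReal (η * F₁ (u / (y₀ + 1))) :=
        ENNReal.ofReal_le_ofReal hu.le
    _ = η * ENNReal.ofReal (F₁ (u / (y₀ + 1))) := by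
        rw [ENNReal.ofReal_mul hη.le, ENNReal.ofReal_coe_nnreal]
    _ ≤ (ENNReal.ofReal ε * k) * ENNReal.ofReal (F₁ (u / (y₀ + 1))) := by gcongr
    _ = ENNReal.ofReal ε * (ENNReal.ofReal (F₁ (u / (y₀ + 1))) * k) := by ring
    _ ≤ _ := by
      gcongr
      rw [hk, ← lintegral_const_mul' _ _ ENNReal.ofReal_ne_top]
      refine (setLIntegral_mono' measurableSet_Ioc fun y hy => ?_).trans (lintegral_mono_set
        (s := Set.Ioc (y₀ + 1) (y₀ + 2)) (fun y hy => ?_))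
      · rw [← ENNReal.ofReal_mul (H₁.pos _).le]
        refine ENNReal.ofReal_le_ofReal ?_
        have hy1 : 0 < y := by linarith [hy.1]
        have := H₂.pos y
        have h3 : F₁ (u / (y₀ + 1)) ≤ F₁ (u / y) := by
          apply H₁.anti
          have := hy.1
          gcongr
        gcongr
      · show 0 < y
        linarith [hy.1]

lemma wp_fubini {F₁ F₂ G₂ : ℝ → ℝ} {L₂ p₂ ρ₂ : ℝ} (H₂ : WPTail F₂ L₂ p₂ ρ₂ G₂)
    (μ : Measure ℝ) [IsProbabilityMeasure μ] (hF0 : ∀ u, 0 ≤ F₁ u)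
    (hμ : ∀ u, μ (Set.Ioi u) = ENNReal.ofReal (F₁ u))
    (hpos : ∀ᵐ x ∂μ, 0 < x) (u : ℝ) (hu : 0 < u) :
    ∫⁻ x, (∫⁻ z in Set.Ioi (u / x), ENNReal.ofReal (p₂ * L₂ * z ^ (p₂ - 1) * F₂ z)) ∂μ =
      ∫⁻ y in Set.Ioi 0, ENNReal.ofReal (F₁ (u / y) * (p₂ * L₂ * y ^ (p₂ - 1) * F₂ y)) := by
  set f := fun z => ENNReal.ofReal (p₂ * L₂ * z ^ (p₂ - 1) * F₂ z) with hf
  have hfm : Measurable f := H₂.f_meas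
  set s : Set (ℝ × ℝ) := {q | u < q.1 * q.2} with hs
  have hsm : MeasurableSet s := measurableSet_lt measurable_const (by fun_prop)
  have e1 : ∫⁻ x, (∫⁻ z in Set.Ioi (u / x), f z) ∂μ =
      ∫⁻ x, (∫⁻ z in Set.Ioi 0, s.indicator (fun q => f q.2) (x, z)) ∂μ := by
    refine lintegral_congr_ae ?_
    filter_upwards [hpos] with x hx
    rw [← lintegral_indicator measurableSet_Ioi, ← lintegral_indicator measurableSet_Ioi]
    refine lintegral_congr fun z => ?_
    by_cases hz : u / x < z
    · have hz' : u < x * z := by rwa [div_lt_iff₀' hx] at hz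
      have hz0 : 0 < z := lt_trans (by positivity) hz
      simp [Set.indicator, hs, hz, hz', hz0]
    · have hz' : ¬ u < x * z := by rwa [div_lt_iff₀' hx] at hz
      simp [Set.indicator, hs, hz, hz']
  rw [e1, lintegral_lintegral_swap]
  · refine setLIntegral_congr_fun measurableSet_Ioi fun z hz => ?_
    have hz : 0 < z := hz
    have : ∀ x, s.indicator (fun q => f q.2) (x, z) = (Set.Ioi (u / z)).indicator (fun _ => f z) x := by
      intro x
      by_cases hx : u / z < x
      · have hx' : u < x * z := by rwa [div_lt_iff₀ hz] at hx
        simp [Set.indicator, hs, hx, hx']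
      · have hx' : ¬ u < x * z := by rwa [div_lt_iff₀ hz] at hx
        simp [Set.indicator, hs, hx, hx']
    simp only [this]
    rw [lintegral_indicator_const measurableSet_Ioi, hμ, ENNReal.ofReal_mul (hF0 _), mul_comm]
  · exact ((hfm.comp measurable_snd).indicator hsm).aemeasurable

lemma wp_sandwich {F₁ G₁ F₂ G₂ : ℝ → ℝ} {L₁ p₁ ρ₁ L₂ p₂ ρ₂ : ℝ} (H₁ : WPTail F₁ L₁ p₁ ρ₁ G₁)
    (H₂ : WPTail F₂ L₂ p₂ ρ₂ G₂) (μ : Measure ℝ) [IsProbabilityMeasure μ]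
    (hμ : ∀ u, μ (Set.Ioi u) = ENNReal.ofReal (F₁ u)) (hpos : ∀ᵐ x ∂μ, 0 < x)
    (Q : ℝ → ENNReal) (hQ : ∀ u, Q u = ∫⁻ y in Set.Ioi 0,
      ENNReal.ofReal (F₁ (u / y) * (p₂ * L₂ * y ^ (p₂ - 1) * F₂ y)))
    (P : ℝ → ENNReal) (hP : ∀ u > 0, P u = ∫⁻ x, ENNReal.ofReal (F₂ (u / x)) ∂μ)
    (δ : ℝ) (hδ : 0 < δ) :
    ∀ᶠ u in atTop, P u ≤ ENNReal.ofReal δ * Q u + ENNReal.ofReal (1 + δ) * Q u ∧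
      Q u ≤ ENNReal.ofReal δ * Q u + ENNReal.ofReal (1 + δ) * P u := by
  obtain ⟨y₀, hy₀, hb⟩ := H₂.S_bounds δ hδ
  set S := fun y => ∫⁻ z in Set.Ioi y, ENNReal.ofReal (p₂ * L₂ * z ^ (p₂ - 1) * F₂ z) with hS
  have hS0 : S 0 < ⊤ := H₂.S_zero
  set s := (S 0).toReal with hs
  have hs0 : 0 ≤ s := ENNReal.toReal_nonneg
  have hSs : S 0 = ENNReal.ofReal s := (ENNReal.ofReal_toReal hS0.ne).symm
  have hSanti : ∀ y, 0 ≤ y → S y ≤ S 0 := fun y hy => lintegral_mono_set (Set.Ioi_subset_Ioi hy)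
  filter_upwards [wp_small H₁ H₂ y₀ hy₀ δ hδ, wp_small H₁ H₂ y₀ hy₀ (δ / (s + 1)) (by positivity),
    eventually_gt_atTop 0] with u hu1 hu2 hu0
  rw [← hQ] at hu1 hu2
  have hQ' : Q u = ∫⁻ x, S (u / x) ∂μ := by
    rw [hQ, wp_fubini H₂ μ (fun u => (H₁.pos u).le) hμ hpos u hu0]
  have hcase : ∀ x > 0, x ∉ Set.Ioi (u / y₀) → y₀ ≤ u / x := by
    intro x hx h
    simp only [Set.mem_Ioi, not_lt] at h
    rw [le_div_iff₀ hy₀] at h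
    rw [le_div_iff₀ hx]; linarith
  constructor
  · calc P u = ∫⁻ x, ENNReal.ofReal (F₂ (u / x)) ∂μ := hP u hu0
      _ ≤ ∫⁻ x, ((Set.Ioi (u / y₀)).indicator (fun _ => 1) x + ENNReal.ofReal (1 + δ) * S (u / x)) ∂μ := by
        refine lintegral_mono_ae ?_
        filter_upwards [hpos] with x hx
        by_cases h : x ∈ Set.Ioi (u / y₀)
        · rw [Set.indicator_of_mem h]
          refine le_trans ?_ le_self_add
          rw [← ENNReal.ofReal_one]
          exact ENNReal.ofReal_le_ofReal (H₂.le_one _)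
        · exact (hb _ (hcase x hx h)).2.trans le_add_self
      _ = ENNReal.ofReal (F₁ (u / y₀)) + ENNReal.ofReal (1 + δ) * Q u := by
        rw [lintegral_add_left (measurable_const.indicator measurableSet_Ioi),
          lintegral_indicator_const measurableSet_Ioi, hμ, one_mul,
          lintegral_const_mul' _ _ ENNReal.ofReal_ne_top, hQ']
      _ ≤ _ := by gcongr
  · calc Q u = ∫⁻ x, S (u / x) ∂μ := hQ'
      _ ≤ ∫⁻ x, ((Set.Ioi (u / y₀)).indicator (fun _ => S 0) x +
            ENNReal.ofReal (1 + δ) * ENNReal.ofReal (F₂ (u / x))) ∂μ := by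
        refine lintegral_mono_ae ?_
        filter_upwards [hpos] with x hx
        by_cases h : x ∈ Set.Ioi (u / y₀)
        · rw [Set.indicator_of_mem h]
          exact (hSanti _ (by positivity)).trans le_self_add
        · exact (hb _ (hcase x hx h)).1.trans le_add_self
      _ = S 0 * ENNReal.ofReal (F₁ (u / y₀)) + ENNReal.ofReal (1 + δ) * P u := by
        rw [lintegral_add_left (measurable_const.indicator measurableSet_Ioi),
          lintegral_indicator_const measurableSet_Ioi, hμ,
          lintegral_const_mul' _ _ ENNReal.ofReal_ne_top, hP u hu0]
      _ ≤ _ := by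
        refine add_le_add ?_ le_rfl
        calc S 0 * ENNReal.ofReal (F₁ (u / y₀)) ≤ ENNReal.ofReal s * (ENNReal.ofReal (δ / (s + 1)) * Q u) := by
              rw [hSs]; gcongr
          _ = ENNReal.ofReal (s * (δ / (s + 1))) * Q u := by
              rw [ENNReal.ofReal_mul hs0, mul_assoc]
          _ ≤ _ := by
              gcongr
              rw [← mul_div_assoc, div_le_iff₀ (by positivity)]
              nlinarith

lemma wp_squeeze (P Q : ℝ → ENNReal) (hPf : ∀ᶠ u in atTop, P u ≠ ⊤)
    (hQf : ∀ᶠ u in atTop, Q u ≠ ⊤ ∧ 0 < (Q u).toReal)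
    (h : ∀ δ : ℝ, 0 < δ → ∀ᶠ u in atTop,
      P u ≤ ENNReal.ofReal δ * Q u + ENNReal.ofReal (1 + δ) * Q u ∧
      Q u ≤ ENNReal.ofReal δ * Q u + ENNReal.ofReal (1 + δ) * P u) :
    Tendsto (fun u => (P u).toReal / (Q u).toReal) atTop (𝓝 1) := by
  rw [Metric.tendsto_nhds]
  intro ε hε
  filter_upwards [hPf, hQf, h (min (ε / 4) (1/2)) (by positivity)] with u h1 h2 h3
  set δ := min (ε / 4) (1/2) with hδd
  have hδ : 0 < δ := by rw [hδd]; positivity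
  have hδ2 : δ ≤ ε / 4 := min_le_left _ _
  have hδ3 : δ ≤ 1/2 := min_le_right _ _
  obtain ⟨h2, h2p⟩ := h2
  rw [← ENNReal.ofReal_toReal h1, ← ENNReal.ofReal_toReal h2] at h3
  set p := (P u).toReal
  set q := (Q u).toReal
  have hp0 : 0 ≤ p := ENNReal.toReal_nonneg
  rw [← ENNReal.ofReal_mul hδ.le, ← ENNReal.ofReal_mul (by positivity), ← ENNReal.ofReal_mul (by positivity),
    ← ENNReal.ofReal_add (by positivity) (by positivity), ← ENNReal.ofReal_add (by positivity) (by positivity),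
    ENNReal.ofReal_le_ofReal_iff (by positivity), ENNReal.ofReal_le_ofReal_iff (by positivity)] at h3
  obtain ⟨k1, k2⟩ := h3
  rw [Real.dist_eq, abs_lt]
  constructor
  · rw [lt_sub_iff_add_lt, lt_div_iff₀ h2p]
    have : (1 - δ) * q ≤ (1 + δ) * p := by linarith
    by_contra! hc
    have h5 : (1 + δ) * p ≤ (1 + δ) * ((-ε + 1) * q) := by gcongr
    have h6 : (1 - δ) * q ≤ (1 + δ) * (-ε + 1) * q := by linarith
    have h7 := le_of_mul_le_mul_right h6 h2p
    nlinarith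
  · rw [sub_lt_iff_lt_add, div_lt_iff₀ h2p]
    nlinarith

theorem weibullian_product_exact_asymptotics
    {Ω : Type*} [MeasureSpace Ω] [IsProbabilityMeasure (ℙ : Measure Ω)]
    (Y₁ Y₂ : Ω → ℝ) (hY₁ : Measurable Y₁) (hY₂ : Measurable Y₂)
    (hindep : IndepFun Y₁ Y₂)
    (hY₁pos : ∀ᵐ ω ∂ℙ, 0 < Y₁ ω) (hY₂pos : ∀ᵐ ω ∂ℙ, 0 < Y₂ ω)
    (L₁ L₂ p₁ p₂ : ℝ) (hL₁ : 0 < L₁) (hL₂ : 0 < L₂) (hp₁ : 0 < p₁) (hp₂ : 0 < p₂)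
    (g₁ g₂ : ℝ → ℝ) (hg₁pos : ∀ u > 0, 0 < g₁ u) (hg₂pos : ∀ u > 0, 0 < g₂ u)
    (ρ₁ ρ₂ : ℝ) (hg₁ : RegularlyVarying g₁ ρ₁) (hg₂ : RegularlyVarying g₂ ρ₂)
    (h₁ : Tendsto (fun u => (ℙ {ω | Y₁ ω > u}).toReal /
        (g₁ u * Real.exp (-(L₁ * u ^ p₁)))) atTop (𝓝 1))
    (h₂ : Tendsto (fun u => (ℙ {ω | Y₂ ω > u}).toReal /
        (g₂ u * Real.exp (-(L₂ * u ^ p₂)))) atTop (𝓝 1))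
    (A B D : ℝ) (hA : A = ((p₁ * L₁) / (p₂ * L₂)) ^ (1 / (p₁ + p₂)))
    (hB : B = L₁ * A ^ (-p₁) + L₂ * A ^ p₂)
    (hD : D = Real.sqrt (2 * Real.pi * (p₁ * L₁) ^ (p₂ / (p₁ + p₂)) *
        (p₂ * L₂) ^ (p₁ / (p₁ + p₂)) / (p₁ + p₂)))
    (c : ℝ → ℝ) (hc : ∀ u, c u = A * u ^ (p₁ / (p₁ + p₂))) :
    Tendsto (fun u => (ℙ {ω | Y₁ ω * Y₂ ω > u}).toReal /
        (D * u ^ (p₁ * p₂ / (2 * (p₁ + p₂))) * g₁ (u / c u) * g₂ (c u) *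
          Real.exp (-(B * u ^ (p₁ * p₂ / (p₁ + p₂)))))) atTop (𝓝 1) := by
  -- tails
  set F₁ : ℝ → ℝ := fun u => (ℙ {ω | Y₁ ω > u}).toReal with hF₁
  set F₂ : ℝ → ℝ := fun u => (ℙ {ω | Y₂ ω > u}).toReal with hF₂
  have tail : ∀ Y : Ω → ℝ, Antitone (fun u => (ℙ {ω | Y ω > u}).toReal) ∧
      (∀ u, 0 ≤ (ℙ {ω | Y ω > u}).toReal) ∧ (∀ u, (ℙ {ω | Y ω > u}).toReal ≤ 1) := by
    intro Y
    refine ⟨fun u v huv => ?_, fun u => ENNReal.toReal_nonneg, fun u => ?_⟩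
    · exact ENNReal.toReal_mono (measure_ne_top _ _)
        (measure_mono fun ω (hω : v < Y ω) => lt_of_le_of_lt huv hω)
    · exact ENNReal.toReal_mono ENNReal.one_ne_top prob_le_one
  obtain ⟨H₁, hG₁⟩ := WPTail.mk' hL₁ hp₁ (tail Y₁).1 (tail Y₁).2.1 (tail Y₁).2.2 hg₁pos hg₁ h₁
  obtain ⟨H₂, hG₂⟩ := WPTail.mk' hL₂ hp₂ (tail Y₂).1 (tail Y₂).2.1 (tail Y₂).2.2 hg₂pos hg₂ h₂
  change WPTail F₁ L₁ p₁ ρ₁ (fun u => F₁ u * _) at H₁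
  change WPTail F₂ L₂ p₂ ρ₂ (fun u => F₂ u * _) at H₂
  set G₁ : ℝ → ℝ := fun u => F₁ u * Real.exp (L₁ * u ^ p₁) with hG₁d
  set G₂ : ℝ → ℝ := fun u => F₂ u * Real.exp (L₂ * u ^ p₂) with hG₂d
  -- constants
  have hsum : 0 < p₁ + p₂ := by positivity
  have hA0 : 0 < A := by rw [hA]; positivity
  set a := L₁ * A ^ (-p₁) with ha
  set b := L₂ * A ^ p₂ with hb
  have ha0 : 0 < a := by positivity
  have hb0 : 0 < b := by positivity
  have hApow : A ^ (p₁ + p₂) = (p₁ * L₁) / (p₂ * L₂) := by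
    rw [hA, ← Real.rpow_mul (by positivity), one_div_mul_cancel hsum.ne', Real.rpow_one]
  have hab : p₁ * a = p₂ * b := by
    have h3 : A ^ p₂ = A ^ (p₁ + p₂) * A ^ (-p₁) := by
      rw [← Real.rpow_add hA0]; congr 1; ring
    rw [ha, hb, h3, hApow]
    field_simp
  have hp2b : p₂ * b = (p₁ * L₁) ^ (p₂ / (p₁ + p₂)) * (p₂ * L₂) ^ (p₁ / (p₁ + p₂)) := by
    have h3 : A ^ p₂ = (p₁ * L₁) ^ (p₂ / (p₁ + p₂)) / (p₂ * L₂) ^ (p₂ / (p₁ + p₂)) := by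
      rw [hA, ← Real.rpow_mul (by positivity), Real.div_rpow (by positivity) (by positivity)]
      rw [show 1 / (p₁ + p₂) * p₂ = p₂ / (p₁ + p₂) by ring]
    have h4 : (p₂ * L₂) ^ (p₁ / (p₁ + p₂)) * (p₂ * L₂) ^ (p₂ / (p₁ + p₂)) = p₂ * L₂ := by
      rw [← Real.rpow_add (by positivity), ← add_div, div_self hsum.ne', Real.rpow_one]
    have h5 : 0 < (p₂ * L₂) ^ (p₂ / (p₁ + p₂)) := by positivity
    rw [hb, h3, ← mul_assoc, ← mul_div_assoc, div_eq_iff h5.ne', mul_assoc (_ ^ _), h4]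
    ring
  have hDs : D = p₂ * b * √(2 * π / (p₂ * b * (p₁ + p₂))) := by
    rw [hD, mul_assoc (2 * π), ← hp2b]
    have h3 : 0 < p₂ * b := by positivity
    rw [show 2 * π * (p₂ * b) / (p₁ + p₂) = (p₂ * b) ^ 2 * (2 * π / (p₂ * b * (p₁ + p₂))) by
      field_simp]
    rw [Real.sqrt_mul (by positivity), Real.sqrt_sq h3.le]
  -- scales
  set r : ℝ → ℝ := fun u => u ^ (p₁ * p₂ / (2 * (p₁ + p₂))) with hr
  set w : ℝ → ℝ := fun u => u / c u with hw
  have hr2 : ∀ u > 0, r u ^ 2 = u ^ (p₁ * p₂ / (p₁ + p₂)) := by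
    intro u hu
    rw [hr, ← Real.rpow_natCast, ← Real.rpow_mul hu.le]
    congr 1
    push_cast
    field_simp
  have hc0 : ∀ u > 0, 0 < c u := fun u hu => by rw [hc]; positivity
  have hwe : ∀ u > 0, w u = A⁻¹ * u ^ (p₂ / (p₁ + p₂)) := by
    intro u hu
    have h3 : u = u ^ (p₁ / (p₁ + p₂)) * u ^ (p₂ / (p₁ + p₂)) := by
      rw [← Real.rpow_add hu, ← add_div, div_self hsum.ne', Real.rpow_one]
    have h4 : 0 < u ^ (p₁ / (p₁ + p₂)) := by positivity
    simp only [hw]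
    rw [hc, div_eq_iff (by positivity)]
    nth_rewrite 1 [h3]
    field_simp
  have hw0 : ∀ u > 0, 0 < w u := fun u hu => div_pos hu (hc0 u hu)
  have hct : Tendsto c atTop atTop := by
    rw [show c = _ from funext hc]
    exact (tendsto_rpow_atTop (by positivity)).const_mul_atTop hA0
  have hwt : Tendsto w atTop atTop := by
    have h3 : Tendsto (fun u : ℝ => A⁻¹ * u ^ (p₂ / (p₁ + p₂))) atTop atTop :=
      (tendsto_rpow_atTop (by positivity)).const_mul_atTop (inv_pos.2 hA0)
    refine h3.congr' ?_
    filter_upwards [eventually_gt_atTop 0] with u hu using (hwe u hu).symm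
  have hrt : Tendsto r atTop atTop := tendsto_rpow_atTop (by positivity)
  have e1 : ∀ u > 0, L₁ * w u ^ p₁ = a * r u ^ 2 := by
    intro u hu
    rw [hwe u hu, hr2 u hu, Real.mul_rpow (by positivity) (by positivity), ← Real.rpow_mul hu.le,
      Real.inv_rpow hA0.le, ha, Real.rpow_neg hA0.le,
      show p₂ / (p₁ + p₂) * p₁ = p₁ * p₂ / (p₁ + p₂) by ring]
    ring
  have e2 : ∀ u > 0, L₂ * c u ^ p₂ = b * r u ^ 2 := by
    intro u hu
    rw [hc, hr2 u hu, Real.mul_rpow hA0.le (by positivity), ← Real.rpow_mul hu.le, hb,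
      show p₁ / (p₁ + p₂) * p₂ = p₁ * p₂ / (p₁ + p₂) by ring]
    ring
  -- the smooth surrogate
  set Q : ℝ → ENNReal := fun u => ∫⁻ y in Set.Ioi 0,
      ENNReal.ofReal (F₁ (u / y) * (p₂ * L₂ * y ^ (p₂ - 1) * F₂ y)) with hQ
  set P : ℝ → ENNReal := fun u => ℙ {ω | Y₁ ω * Y₂ ω > u} with hP
  have hI := wp_Q_lim H₁ H₂ a b ha0 hb0 hab w c r hwt hct hrt
  set I : ℝ → ENNReal := fun u => ∫⁻ t, ENNReal.ofReal
        ((G₁ (w u * exp (-(t / r u))) / G₁ (w u)) * (G₂ (c u * exp (t / r u)) / G₂ (c u)) *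
          exp (p₂ * (t / r u)) * exp (-(r u ^ 2 * (a * (exp (-p₁ * t / r u) - 1) +
            b * (exp (p₂ * t / r u) - 1))))) with hId
  set s := √(2 * π / (p₂ * b * (p₁ + p₂))) with hs
  have hs0 : 0 < s := by rw [hs]; positivity
  have hQI : ∀ u > 0, Q u = ENNReal.ofReal (p₂ * b * (r u * G₁ (w u) * G₂ (c u) *
      exp (-((a + b) * r u ^ 2)))) * I u := by
    intro u hu
    have h3 := wp_Q_eq H₁ H₂ a b (w u) (c u) (r u) (hw0 u hu) (hc0 u hu)
      (Real.rpow_pos_of_pos hu _) (e1 u hu) (e2 u hu)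
    rw [show w u * c u = u from div_mul_cancel₀ u (hc0 u hu).ne'] at h3
    exact h3
  have hIr : Tendsto (fun u => (I u).toReal) atTop (𝓝 s) := by
    have h3 := (ENNReal.tendsto_toReal ENNReal.ofReal_ne_top).comp hI
    rwa [ENNReal.toReal_ofReal hs0.le] at h3
  have hRpos : ∀ u > 0, 0 < p₂ * b * (r u * G₁ (w u) * G₂ (c u) * exp (-((a + b) * r u ^ 2))) := by
    intro u hu
    have h3 : 0 < r u := Real.rpow_pos_of_pos hu _
    have h4 := H₁.Gpos (w u)
    have h5 := H₂.Gpos (c u)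
    positivity
  have hQr : ∀ u > 0, (Q u).toReal = p₂ * b * (r u * G₁ (w u) * G₂ (c u) *
      exp (-((a + b) * r u ^ 2))) * (I u).toReal := by
    intro u hu
    rw [hQI u hu, ENNReal.toReal_mul, ENNReal.toReal_ofReal (hRpos u hu).le]
  have hQf : ∀ᶠ u in atTop, Q u ≠ ⊤ ∧ 0 < (Q u).toReal := by
    filter_upwards [hI.eventually (gt_mem_nhds (show ENNReal.ofReal s < ⊤ from ENNReal.ofReal_lt_top)),
      hIr.eventually (lt_mem_nhds hs0), eventually_gt_atTop 0] with u h3 h4 h5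
    constructor
    · rw [hQI u h5]; exact ENNReal.mul_ne_top ENNReal.ofReal_ne_top h3.ne
    · rw [hQr u h5]; exact mul_pos (hRpos u h5) h4
  -- law of the product
  set μ₁ := (ℙ : Measure Ω).map Y₁ with hμ₁
  set μ₂ := (ℙ : Measure Ω).map Y₂ with hμ₂
  have : IsProbabilityMeasure μ₁ := Measure.isProbabilityMeasure_map hY₁.aemeasurable
  have : IsProbabilityMeasure μ₂ := Measure.isProbabilityMeasure_map hY₂.aemeasurable
  have hμ₁t : ∀ u, μ₁ (Set.Ioi u) = ENNReal.ofReal (F₁ u) := by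
    intro u
    rw [hμ₁, Measure.map_apply hY₁ measurableSet_Ioi, hF₁, ENNReal.ofReal_toReal (measure_ne_top _ _)]
    rfl
  have hμ₂t : ∀ u, μ₂ (Set.Ioi u) = ENNReal.ofReal (F₂ u) := by
    intro u
    rw [hμ₂, Measure.map_apply hY₂ measurableSet_Ioi, hF₂, ENNReal.ofReal_toReal (measure_ne_top _ _)]
    rfl
  have hpos : ∀ᵐ x ∂μ₁, 0 < x := by
    rw [hμ₁, ae_map_iff hY₁.aemeasurable measurableSet_Ioi]
    exact hY₁pos
  have hPP : ∀ u > 0, P u = ∫⁻ x, ENNReal.ofReal (F₂ (u / x)) ∂μ₁ := by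
    intro u hu
    have hsm : MeasurableSet {q : ℝ × ℝ | u < q.1 * q.2} :=
      measurableSet_lt measurable_const (by fun_prop)
    have h3 : P u = (μ₁.prod μ₂) {q : ℝ × ℝ | u < q.1 * q.2} := by
      rw [hμ₁, hμ₂, ← (indepFun_iff_map_prod_eq_prod_map_map hY₁.aemeasurable hY₂.aemeasurable).1 hindep,
        Measure.map_apply (hY₁.prodMk hY₂) hsm]
      rfl
    rw [h3, Measure.prod_apply hsm]
    refine lintegral_congr_ae ?_
    filter_upwards [hpos] with x hx
    rw [← hμ₂t]
    congr 1
    ext y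
    simp only [Set.mem_preimage, Set.mem_setOf_eq, Set.mem_Ioi]
    rw [div_lt_iff₀' hx]
  have hPQ := wp_squeeze P Q (Eventually.of_forall fun u => measure_ne_top _ _) hQf
    (fun δ hδ => wp_sandwich H₁ H₂ μ₁ hμ₁t hpos Q (fun _ => rfl) P hPP δ hδ)
  have hfin := ((hPQ.mul (hIr.div_const s)).mul (hG₁.comp hwt)).mul (hG₂.comp hct)
  rw [div_self hs0.ne'] at hfin
  simp only [mul_one] at hfin
  refine hfin.congr' ?_
  filter_upwards [hQf, eventually_gt_atTop 0] with u h3 h5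
  have k1 := hg₁pos (w u) (hw0 u h5)
  have k2 := hg₂pos (c u) (hc0 u h5)
  have k3 : 0 < r u := Real.rpow_pos_of_pos h5 _
  have k4 := H₁.Gpos (w u)
  have k5 := H₂.Gpos (c u)
  have k6 : 0 < (I u).toReal := by
    have := h3.2
    rw [hQr u h5] at this
    exact pos_of_mul_pos_right this (hRpos u h5).le
  change (P u).toReal / (Q u).toReal * ((I u).toReal / s) * (G₁ (w u) / g₁ (w u)) *
    (G₂ (c u) / g₂ (c u)) = (P u).toReal / (D * r u * g₁ (w u) * g₂ (c u) * _)
  rw [hQr u h5, hDs, hB, ← hr2 u h5]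
  field_simp
end

section
/- Let Y1, Y2 be independent positive random variables with Weibullian tails P(Y_i > u) ∼ g_i(u) exp(-L_i u^{p_i}), g_i regularly varying, L_i, p_i > 0. Then P(Y1Y2 > u) ∼ D u^{p1p2/(2(p1+p2))} P(Y1 > u/c_u) P(Y2 > c_u) as u → ∞, where c_u = A u^{p1/(p1+p2)}, A = ((p1L1)/(p2L2))^{1/(p1+p2)}, and D = (2π (p1L1)^{p2/(p1+p2)} (p2L2)^{p1/(p1+p2)}/(p1+p2))^{1/2}. -/
open MeasureTheory ProbabilityTheory Filter Topology Real

lemma uct (h : ℝ → ℝ) (hm : Measurable h)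
    (hs : ∀ s, Tendsto (fun t => h (t + s) - h t) atTop (𝓝 0)) (δ : ℝ) (hδ : 0 < δ) :
    ∀ᶠ t in atTop, ∀ s, 0 ≤ s → s ≤ 1 → |h (t + s) - h t| ≤ δ := by
  set k : ℝ → ℝ → ℝ := fun t s => min 1 |h (t + s) - h t| with hk
  have hkm : ∀ t, Measurable (k t) := fun t => by
    simp only [hk]; fun_prop
  have hk0 : ∀ t s, 0 ≤ k t s := fun t s => le_min zero_le_one (abs_nonneg _)
  have hk1 : ∀ t s, k t s ≤ 1 := fun t s => min_le_left _ _
  have hki : ∀ t a b, IntervalIntegrable (k t) volume a b := fun t a b => by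
    refine (intervalIntegrable_const (c := (1:ℝ))).mono_fun (hkm t).aestronglyMeasurable ?_
    refine Eventually.of_forall fun s => ?_
    show ‖k t s‖ ≤ ‖(1:ℝ)‖
    rw [Real.norm_of_nonneg (hk0 t s)]; simpa using hk1 t s
  have hlim : Tendsto (fun t => ∫ s in (0:ℝ)..2, k t s) atTop (𝓝 (∫ s in (0:ℝ)..2, (0:ℝ))) := by
    refine intervalIntegral.tendsto_integral_filter_of_dominated_convergence (fun _ => 1)
      (Eventually.of_forall fun t => (hkm t).aestronglyMeasurable) ?_ intervalIntegrable_const ?_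
    · refine Eventually.of_forall fun t => Eventually.of_forall fun s _ => ?_
      rw [Real.norm_of_nonneg (hk0 t s)]; exact hk1 t s
    · refine Eventually.of_forall fun s _ => ?_
      have := (tendsto_const_nhds (x := (1:ℝ))).min (hs s).abs
      simpa [hk] using this
  simp only [intervalIntegral.integral_zero] at hlim
  set η := min δ (1/2) with hη
  have hη0 : 0 < η := by positivity
  have ev := hlim.eventually (gt_mem_nhds (half_pos hη0))
  obtain ⟨t0, ht0⟩ := eventually_atTop.1 ev
  filter_upwards [eventually_ge_atTop t0] with t ht s hs0 hs1
  have e1 := ht0 t ht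
  have e2 := ht0 (t + s) (by linarith)
  have key : min 1 |h (t + s) - h t| ≤ (∫ r in (1:ℝ)..2, k t r) + ∫ r in (1:ℝ)..2, k (t+s) (r - s) := by
    have hi2 : IntervalIntegrable (fun r => k (t+s) (r - s)) volume 1 2 := by
      have := (hki (t+s) (1-s) (2-s)).comp_sub_right s
      simpa using this
    rw [← intervalIntegral.integral_add (hki t 1 2) hi2]
    have : min 1 |h (t + s) - h t| = ∫ r in (1:ℝ)..2, min 1 |h (t + s) - h t| := by
      simp; norm_num
    rw [this]
    refine intervalIntegral.integral_mono_on (by norm_num) intervalIntegrable_const ((hki t 1 2).add hi2) ?_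
    intro r _
    simp only [hk]
    have : t + s + (r - s) = t + r := by ring
    rw [this]
    have := abs_sub_abs_le_abs_sub (h (t+r) - h t) (h (t+r) - h (t+s))
    have t3 : |h (t+s) - h t| ≤ |h (t+r) - h t| + |h (t+r) - h (t+s)| := by
      have := abs_sub (h (t+r) - h t) (h (t+r) - h (t+s))
      refine le_trans (le_of_eq ?_) this
      congr 1; ring
    have p1 := abs_nonneg (h (t+r) - h t)
    have p2 := abs_nonneg (h (t+r) - h (t+s))
    rcases min_cases (1:ℝ) |h (t+r) - h t| with h1 | h1 <;>
    rcases min_cases (1:ℝ) |h (t+r) - h (t+s)| with h2 | h2 <;>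
    rcases min_cases (1:ℝ) |h (t+s) - h t| with h3 | h3 <;> rw [h1.1, h2.1, h3.1] <;> linarith
  have i1 : (∫ r in (1:ℝ)..2, k t r) ≤ ∫ r in (0:ℝ)..2, k t r :=
    intervalIntegral.integral_mono_interval (by norm_num) (by norm_num) (le_refl _)
      (Eventually.of_forall (hk0 t)) (hki _ _ _)
  have i2 : (∫ r in (1:ℝ)..2, k (t+s) (r-s)) ≤ ∫ r in (0:ℝ)..2, k (t+s) r := by
    rw [intervalIntegral.integral_comp_sub_right (fun r => k (t+s) r)]
    exact intervalIntegral.integral_mono_interval (by linarith) (by linarith) (by linarith)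
      (Eventually.of_forall (hk0 _)) (hki _ _ _)
  have : min 1 |h (t + s) - h t| < η := by linarith
  have hη1 : η ≤ 1/2 := min_le_right _ _
  have hη2 : η ≤ δ := min_le_left _ _
  rcases min_cases (1:ℝ) |h (t+s) - h t| with h3 | h3 <;> linarith [h3.1]

lemma linbound (h : ℝ → ℝ) 
    (hs : ∀ᶠ t in atTop, ∀ s, 0 ≤ s → s ≤ 1 → |h (t + s) - h t| ≤ 1) :
    ∃ C, ∀ᶠ t in atTop, |h t| ≤ C + t := by
  obtain ⟨t0, ht0⟩ := eventually_atTop.1 hs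
  have ind : ∀ n : ℕ, ∀ s, 0 ≤ s → s ≤ 1 → |h (t0 + n + s) - h t0| ≤ n + 1 := by
    intro n
    induction n with
    | zero => intro s h0 h1; simpa using ht0 t0 le_rfl s h0 h1
    | succ n ih =>
      intro s h0 h1
      have a1 := ih 1 zero_le_one le_rfl
      have a2 := ht0 (t0 + n + 1) (by have : (0:ℝ) ≤ n := n.cast_nonneg
                                      linarith) s h0 h1
      push_cast
      have := abs_add_le (h (t0 + n + 1 + s) - h (t0 + n + 1)) (h (t0 + n + 1) - h t0)
      rw [sub_add_sub_cancel] at this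
      rw [← add_assoc]
      linarith
  refine ⟨|h t0| + 1 - t0, ?_⟩
  filter_upwards [eventually_ge_atTop t0] with t ht
  have f1 := Nat.floor_le (sub_nonneg.2 ht)
  have f2 := Nat.lt_floor_add_one (t - t0)
  have := ind ⌊t - t0⌋₊ (t - t0 - ⌊t - t0⌋₊) (by linarith) (by linarith)
  rw [show t0 + (⌊t - t0⌋₊:ℝ) + (t - t0 - ⌊t - t0⌋₊) = t by ring] at this
  have := abs_sub_abs_le_abs_sub (h t) (h t0)
  linarith

lemma rv_props (G : ℝ → ℝ) (hm : Measurable G) (hpos : ∀ z, 0 < G z) (ρ : ℝ)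
    (hG : ∀ x : ℝ, 0 < x → Tendsto (fun z => G (z * x) / G z) atTop (𝓝 (x ^ ρ))) :
    (∀ δ, 0 < δ → ∃ ε0, 0 < ε0 ∧ ∀ᶠ z in atTop, ∀ r, |r| ≤ ε0 →
      (1 - δ) * G z ≤ G (z * exp r) ∧ G (z * exp r) ≤ (1 + δ) * G z) ∧
    (∀ θ, 0 < θ → ∀ᶠ z in atTop, exp (-(θ * z)) ≤ G z ∧ G z ≤ exp (θ * z)) := by
  set h : ℝ → ℝ := fun t => log (G (exp t)) - ρ * t with hh
  have hhm : Measurable h := by simp only [hh]; fun_prop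
  have hs : ∀ s, Tendsto (fun t => h (t + s) - h t) atTop (𝓝 0) := by
    intro s
    have h1 := ((hG (exp s) (exp_pos s)).comp tendsto_exp_atTop).log (by positivity)
    rw [← exp_mul, log_exp] at h1
    have h2 := h1.sub_const (s * ρ)
    rw [sub_self] at h2
    refine h2.congr fun t => ?_
    simp only [Function.comp, hh]
    rw [log_div (hpos _).ne' (hpos _).ne', exp_add]; ring
  have hu := uct h hhm hs
  constructor
  · intro δ hδ
    have hl : 0 < log (1 + δ) := log_pos (by linarith)
    set d := log (1 + δ) / 2 with hd
    have hd0 : 0 < d := by positivity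
    refine ⟨min 1 (d / (|ρ| + 1)), by positivity, ?_⟩
    obtain ⟨t0, ht0⟩ := eventually_atTop.1 (hu d hd0)
    filter_upwards [eventually_ge_atTop (exp (t0 + 1))] with z hz r hr
    have hz0 : 0 < z := lt_of_lt_of_le (exp_pos _) hz
    have hlz : t0 + 1 ≤ log z := (le_log_iff_exp_le hz0).2 hz
    have hr1 : |r| ≤ 1 := hr.trans (min_le_left _ _)
    have hr2 : |ρ * r| ≤ d := by
      have : |r| ≤ d / (|ρ| + 1) := hr.trans (min_le_right _ _)
      rw [le_div_iff₀ (by positivity)] at this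
      rw [abs_mul]; nlinarith [abs_nonneg r]
    have key : |h (log z + r) - h (log z)| ≤ d := by
      rcases le_total 0 r with h0 | h0
      · exact ht0 _ (by linarith) r h0 (by rwa [abs_of_nonneg h0] at hr1)
      · rw [abs_of_nonpos h0] at hr1
        have := ht0 (log z + r) (by linarith) (-r) (by linarith) hr1
        rw [abs_sub_comm]; simpa using this
    have e : h (log z + r) - h (log z) + ρ * r = log (G (z * exp r) / G z) := by
      simp only [hh]
      rw [log_div (hpos _).ne' (hpos _).ne', exp_add, exp_log hz0]; ring
    have k2 : |log (G (z * exp r) / G z)| ≤ log (1 + δ) := by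
      rw [← e]; have := abs_add_le (h (log z + r) - h (log z)) (ρ * r); linarith
    have hq : 0 < G (z * exp r) / G z := div_pos (hpos _) (hpos _)
    obtain ⟨k3, k4⟩ := abs_le.1 k2
    rw [← log_inv, log_le_log_iff (by positivity) hq] at k3
    rw [log_le_log_iff hq (by positivity)] at k4
    rw [div_le_iff₀ (hpos _)] at k4
    rw [le_div_iff₀ (hpos _)] at k3
    refine ⟨le_trans ?_ k3, k4⟩
    refine mul_le_mul_of_nonneg_right ?_ (hpos _).le
    rw [← one_div, le_div_iff₀ (by linarith)]; nlinarith
  · intro θ hθ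
    obtain ⟨C, hC⟩ := linbound h (hu 1 one_pos)
    have hlin : ∀ᶠ t : ℝ in atTop, C + (1 + |ρ|) * t ≤ θ * exp t := by
      have h1 : Tendsto (fun t : ℝ => C * exp (-t) + (1 + |ρ|) * (t ^ 1 * exp (-t))) atTop (𝓝 (C * 0 + (1 + |ρ|) * 0)) :=
        (tendsto_exp_neg_atTop_nhds_zero.const_mul C).add ((tendsto_pow_mul_exp_neg_atTop_nhds_zero 1).const_mul _)
      simp only [mul_zero, add_zero] at h1
      filter_upwards [h1.eventually (gt_mem_nhds hθ)] with t ht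
      have := mul_le_mul_of_nonneg_right ht.le (exp_pos t).le
      have ee : exp (-t) * exp t = 1 := by rw [← exp_add]; simp
      calc C + (1 + |ρ|) * t = (C * exp (-t) + (1 + |ρ|) * (t ^ 1 * exp (-t))) * exp t := by
            linear_combination -(C + (1 + |ρ|) * t) * ee
        _ ≤ _ := this
    have := tendsto_log_atTop.eventually ((hC.and hlin).and (eventually_ge_atTop 0))
    filter_upwards [this, eventually_gt_atTop 0] with z hz hz0
    obtain ⟨⟨h1, h2⟩, h3⟩ := hz
    rw [exp_log hz0] at h2
    have e : log (G z) = h (log z) + ρ * log z := by simp only [hh]; rw [exp_log hz0]; ring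
    have b : |log (G z)| ≤ θ * z := by
      rw [e]
      have := abs_add_le (h (log z)) (ρ * log z)
      rw [abs_mul, abs_of_nonneg h3] at this
      linarith
    obtain ⟨b1, b2⟩ := abs_le.1 b
    exact ⟨(le_log_iff_exp_le (hpos z)).1 b1, (log_le_iff_le_exp (hpos z)).1 b2⟩

lemma exp_moment {Ω : Type*} [MeasurableSpace Ω] (P : Measure Ω) [IsProbabilityMeasure P]
    (Z : Ω → ℝ) (hZ : Measurable Z) (s κ : ℝ) (hs : 0 < s) (hsκ : s < κ)
    (hT : ∀ᶠ z in atTop, P.real {ω | z < Z ω} ≤ exp (-(κ * z))) :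
    Integrable (fun ω => exp (s * Z ω)) P := by
  obtain ⟨z0, hz0⟩ := eventually_atTop.1 hT
  have hm : Measurable (fun ω => exp (s * Z ω)) := by fun_prop
  refine ⟨hm.aestronglyMeasurable, ?_⟩
  rw [hasFiniteIntegral_iff_ofReal (Eventually.of_forall fun ω => (exp_pos _).le)]
  rw [lintegral_eq_lintegral_meas_lt P (Eventually.of_forall fun ω => (exp_pos _).le) hm.aemeasurable]
  set t0 := exp (s * z0) with ht0
  have ht0p : 0 < t0 := exp_pos _
  have hsub : Set.Ioi (0:ℝ) = Set.Ioc 0 t0 ∪ Set.Ioi t0 := (Set.Ioc_union_Ioi_eq_Ioi ht0p.le).symm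
  rw [hsub]
  refine lt_of_le_of_lt (lintegral_union_le _ _ _) (ENNReal.add_lt_top.2 ⟨?_, ?_⟩)
  · refine lt_of_le_of_lt (lintegral_mono (g := fun _ => 1) fun t => prob_le_one) ?_
    simp
  · have hi : IntegrableOn (fun t : ℝ => t ^ (-(κ / s))) (Set.Ioi t0) := by
      refine integrableOn_Ioi_rpow_of_lt ?_ ht0p
      have : 1 < κ / s := (one_lt_div hs).2 hsκ
      linarith
    refine lt_of_le_of_lt (setLIntegral_mono' (g := fun t => ENNReal.ofReal (t ^ (-(κ / s)))) measurableSet_Ioi ?_) hi.lintegral_lt_top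
    intro t ht
    have htp : 0 < t := ht0p.trans ht
    have e : {ω | t < exp (s * Z ω)} = {ω | log t / s < Z ω} := by
      ext ω; simp only [Set.mem_ofPred_eq]
      rw [← log_lt_iff_lt_exp htp, div_lt_iff₀ hs, mul_comm]
    rw [e, ← ofReal_measureReal]
    refine ENNReal.ofReal_le_ofReal ((hz0 _ ?_).trans (le_of_eq ?_))
    · rw [le_div_iff₀ hs, mul_comm]
      exact (le_log_iff_exp_le htp).2 (le_of_lt ht)
    · rw [rpow_def_of_pos htp]; congr 1; ring

noncomputable def phi (a b r : ℝ) : ℝ := a * (exp (-(b * r)) - 1) + b * (exp (a * r) - 1)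

lemma phi_ge (a b r : ℝ) (ha : 0 < a) (hb : 0 < b) :
    min (b * a ^ 2 / 2) (a * b ^ 2 / 2) * r ^ 2 ≤ phi a b r := by
  have e1 := add_one_le_exp (-(b * r))
  have e2 := add_one_le_exp (a * r)
  unfold phi
  rcases le_total 0 r with h | h
  · have q := quadratic_le_exp_of_nonneg (mul_nonneg ha.le h)
    have := min_le_left (b * a ^ 2 / 2) (a * b ^ 2 / 2)
    have := mul_le_mul_of_nonneg_right this (sq_nonneg r)
    nlinarith
  · have q := quadratic_le_exp_of_nonneg (x := -(b * r)) (by nlinarith)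
    have := min_le_right (b * a ^ 2 / 2) (a * b ^ 2 / 2)
    have := mul_le_mul_of_nonneg_right this (sq_nonneg r)
    nlinarith

lemma exp_taylor_lim : Tendsto (fun x : ℝ => (exp x - 1 - x) / x ^ 2) (𝓝[≠] 0) (𝓝 (1/2)) := by
  have h : ∀ᶠ x : ℝ in 𝓝[≠] 0, |(exp x - 1 - x) / x ^ 2 - 1/2| ≤ |x| := by
    have : ∀ᶠ x : ℝ in 𝓝[≠] 0, |x| ≤ 1 := by
      refine nhdsWithin_le_nhds ?_
      have := (continuous_abs (G := ℝ)).tendsto 0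
      rw [abs_zero] at this
      filter_upwards [this.eventually (gt_mem_nhds one_pos)] with x hx using hx.le
    filter_upwards [this, self_mem_nhdsWithin] with x hx hx0
    have hx0 : x ≠ 0 := hx0
    have := Real.exp_bound hx (n := 3) (by norm_num)
    simp [Finset.sum_range_succ, Nat.factorial] at this
    have e : (exp x - 1 - x) / x ^ 2 - 1/2 = (exp x - (1 + x + x ^ 2 / 2)) / x ^ 2 := by
      field_simp; ring
    rw [e, abs_div, abs_of_nonneg (sq_nonneg x), div_le_iff₀ (by positivity)]
    have : |x| ^ 3 = |x| * x ^ 2 := by rw [← sq_abs x]; ring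
    have p : 0 ≤ |x| * x ^ 2 := by positivity
    norm_num at *
    linarith
  have h0 : Tendsto (fun x : ℝ => |x|) (𝓝[≠] 0) (𝓝 0) := by
    have := (continuous_abs (G := ℝ)).tendsto 0
    rw [abs_zero] at this
    exact this.mono_left nhdsWithin_le_nhds
  rw [← tendsto_sub_nhds_zero_iff]
  exact squeeze_zero_norm' h h0

lemma exp_scale (k s : ℝ) : Tendsto (fun N : ℝ => N * (exp (k * (s / √N)) - 1 - k * (s / √N))) atTop (𝓝 (k ^ 2 * s ^ 2 / 2)) := by
  by_cases hks : k * s = 0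
  · have : ∀ N : ℝ, k * (s / √N) = 0 := fun N => by rw [← mul_div_assoc, hks, zero_div]
    simp only [this]
    have : k ^ 2 * s ^ 2 = 0 := by rw [← mul_pow, hks]; simp
    simp [this]
  · have h1 : Tendsto (fun N : ℝ => k * s / √N) atTop (𝓝[≠] 0) := by
      refine tendsto_nhdsWithin_iff.2 ⟨tendsto_sqrt_atTop.const_div_atTop _, ?_⟩
      filter_upwards [eventually_gt_atTop 0] with N hN
      exact div_ne_zero hks (by positivity)
    have := (exp_taylor_lim.comp h1).mul_const ((k * s) ^ 2)
    rw [show (1/2 : ℝ) * (k * s) ^ 2 = k ^ 2 * s ^ 2 / 2 by ring] at this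
    refine this.congr' ?_
    filter_upwards [eventually_gt_atTop 0] with N hN
    simp only [Function.comp]
    rw [div_pow, sq_sqrt hN.le, ← mul_div_assoc]
    generalize exp (k * s / √N) - 1 - k * s / √N = E
    generalize k * s = q at hks
    field_simp

lemma phi_scale (a b s : ℝ) : Tendsto (fun N : ℝ => N * phi a b (s / √N)) atTop
    (𝓝 (a * b * (a + b) / 2 * s ^ 2)) := by
  have := ((exp_scale (-b) s).const_mul a).add ((exp_scale a s).const_mul b)
  rw [show a * ((-b) ^ 2 * s ^ 2 / 2) + b * (a ^ 2 * s ^ 2 / 2) = a * b * (a + b) / 2 * s ^ 2 by ring] at this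
  refine this.congr fun N => ?_
  unfold phi
  rw [show -(b * (s / √N)) = -b * (s / √N) by ring]
  ring

lemma phi_cont (a b : ℝ) : Continuous (phi a b) := by unfold phi; fun_prop

lemma laplace (a b ε : ℝ) (ha : 0 < a) (hb : 0 < b) (hε : 0 < ε) :
    Tendsto (fun N : ℝ => √N * ∫ r in (-ε)..ε, exp (-(b * r)) * exp (-(N * phi a b r))) atTop
      (𝓝 (√(2 * π / (a * b * (a + b))))) := by
  set k := min (b * a ^ 2 / 2) (a * b ^ 2 / 2) with hk
  have hk0 : 0 < k := by positivity
  set F : ℝ → ℝ → ℝ := fun N s => (Set.Ioc (-(ε * √N)) (ε * √N)).indicator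
    (fun s => exp (-(b * (s / √N))) * exp (-(N * phi a b (s / √N)))) s with hF
  have h1 : Tendsto (fun N => ∫ s, F N s) atTop (𝓝 (∫ s : ℝ, exp (-(a * b * (a + b) / 2) * s ^ 2))) := by
    refine tendsto_integral_filter_of_dominated_convergence (fun s => exp (b * ε) * exp (-k * s ^ 2)) ?_ ?_ ?_ ?_
    · refine Eventually.of_forall fun N => ?_
      refine Measurable.aestronglyMeasurable ?_
      refine Measurable.indicator ?_ measurableSet_Ioc
      have := (phi_cont a b).measurable
      fun_prop
    · filter_upwards [eventually_gt_atTop 0] with N hN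
      refine Eventually.of_forall fun s => ?_
      have hsN : 0 < √N := sqrt_pos.2 hN
      simp only [hF]
      by_cases hs : s ∈ Set.Ioc (-(ε * √N)) (ε * √N)
      · rw [Set.indicator_of_mem hs, Real.norm_of_nonneg (by positivity)]
        have b1 : -ε ≤ s / √N := by rw [le_div_iff₀ hsN]; linarith [hs.1]
        have b2 := phi_ge a b (s / √N) ha hb
        rw [← hk, div_pow, sq_sqrt hN.le] at b2
        have b3 := mul_le_mul_of_nonneg_left b2 hN.le
        rw [show N * (k * (s ^ 2 / N)) = k * s ^ 2 by field_simp] at b3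
        gcongr
        · nlinarith
        · linarith
      · rw [Set.indicator_of_notMem hs]; simp; positivity
    · exact (integrable_exp_neg_mul_sq hk0).const_mul _
    · refine Eventually.of_forall fun s => ?_
      have l1 : Tendsto (fun N : ℝ => exp (-(b * (s / √N))) * exp (-(N * phi a b (s / √N)))) atTop
          (𝓝 (exp (-(b * 0)) * exp (-(a * b * (a + b) / 2 * s ^ 2)))) := by
        refine Tendsto.mul ?_ ?_
        · exact (continuous_exp.tendsto _).comp ((tendsto_sqrt_atTop.const_div_atTop s).const_mul b).neg
        · exact (continuous_exp.tendsto _).comp (phi_scale a b s).neg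
      rw [show exp (-(b * 0)) * exp (-(a * b * (a + b) / 2 * s ^ 2)) = exp (-(a * b * (a + b) / 2) * s ^ 2) by
        simp] at l1
      refine l1.congr' ?_
      have : Tendsto (fun N : ℝ => ε * √N) atTop atTop := tendsto_sqrt_atTop.const_mul_atTop hε
      filter_upwards [this.eventually (eventually_gt_atTop |s|)] with N hN
      simp only [hF]
      rw [Set.indicator_of_mem]
      have := abs_lt.1 hN
      exact ⟨this.1, this.2.le⟩
  rw [integral_gaussian, show π / (a * b * (a + b) / 2) = 2 * π / (a * b * (a + b)) by field_simp] at h1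
  refine h1.congr' ?_
  filter_upwards [eventually_gt_atTop 0] with N hN
  have hsN : 0 < √N := sqrt_pos.2 hN
  simp only [hF]
  rw [integral_indicator measurableSet_Ioc, ← intervalIntegral.integral_of_le (by nlinarith)]
  have := intervalIntegral.integral_comp_div (fun r => exp (-(b * r)) * exp (-(N * phi a b r))) hsN.ne' (a := -(ε * √N)) (b := ε * √N)
  rw [this, neg_div, mul_div_cancel_right₀ _ hsN.ne', smul_eq_mul]

lemma mix {Ω : Type*} [MeasurableSpace Ω] (P : Measure Ω) [IsProbabilityMeasure P]
    (X R : Ω → ℝ) (hX : Measurable X) (hR : Measurable R) (hind : IndepFun X R P)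
    (f : ℝ → ℝ) (hf : Measurable f) (I : Set ℝ) (hI : MeasurableSet I) :
    P.real {ω | R ω ∈ I ∧ f (R ω) < X ω} = ∫ ω in R ⁻¹' I, P.real {ω' | f (R ω) < X ω'} ∂P := by
  have hmp := (indepFun_iff_map_prod_eq_prod_map_map hX.aemeasurable hR.aemeasurable).1 hind
  set S : Set (ℝ × ℝ) := {p | p.2 ∈ I ∧ f p.2 < p.1} with hS
  have hSm : MeasurableSet S :=
    (measurable_snd hI).inter (measurableSet_lt (hf.comp measurable_snd) measurable_fst)
  have e1 : P {ω | R ω ∈ I ∧ f (R ω) < X ω} = (P.map (fun ω => (X ω, R ω))) S := by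
    rw [Measure.map_apply (hX.prodMk hR) hSm]; rfl
  have hPX : IsProbabilityMeasure (P.map X) := Measure.isProbabilityMeasure_map hX.aemeasurable
  have hPR : IsProbabilityMeasure (P.map R) := Measure.isProbabilityMeasure_map hR.aemeasurable
  have hmeas : Measurable fun r => (P.map X) ((fun x => (x, r)) ⁻¹' S) := measurable_measure_prodMk_right hSm
  rw [hmp, Measure.prod_apply_symm hSm, lintegral_map hmeas hR] at e1
  have e2 : ∀ ω, (P.map X) ((fun x => (x, R ω)) ⁻¹' S) = (R ⁻¹' I).indicator (fun ω => P {ω' | f (R ω) < X ω'}) ω := by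
    intro ω
    rw [Measure.map_apply hX (measurable_prodMk_right hSm)]
    by_cases h : R ω ∈ I
    · rw [Set.indicator_of_mem (show ω ∈ R ⁻¹' I from h)]
      congr 1; ext ω'; simp [hS, h]
    · rw [Set.indicator_of_notMem (show ω ∉ R ⁻¹' I from h)]
      convert measure_empty (μ := P); ext ω'; simp [hS, h]
  simp_rw [e2] at e1
  rw [lintegral_indicator (hR hI)] at e1
  rw [measureReal_def, e1]
  symm
  refine integral_toReal ?_ (Eventually.of_forall fun ω => measure_lt_top _ _)
  have hme : Measurable fun ω => P {ω' | f (R ω) < X ω'} := by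
    have hS2 : MeasurableSet {p : ℝ × ℝ | f p.2 < p.1} := measurableSet_lt (hf.comp measurable_snd) measurable_fst
    have := (measurable_measure_prodMk_right (μ := P.map X) hS2).comp hR
    convert this using 2 with ω
    simp only [Function.comp]
    rw [Measure.map_apply hX (measurable_prodMk_right hS2)]; rfl
  exact hme.aemeasurable

lemma main_bounds {Ω : Type*} [MeasurableSpace Ω] (P : Measure Ω) [IsProbabilityMeasure P]
    (X R : Ω → ℝ) (hX : Measurable X) (hR : Measurable R) (hind : IndepFun X R P)
    (f : ℝ → ℝ) (hf : Measurable f) (ε : ℝ) (hε : 0 < ε) (q q' : ℝ → ℝ)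
    (hq : ∀ r, HasDerivAt q (q' r) r) (hq'c : Continuous q') (hq0 : ∀ r, 0 ≤ q r)
    (hq'0 : ∀ r, 0 ≤ q' r) (C1 C2 : ℝ) (hC1 : 0 ≤ C1) (hC2 : 0 ≤ C2)
    (h1 : ∀ r, |r| ≤ ε → C1 * q r ≤ P.real {ω | f r < X ω})
    (h2 : ∀ r, |r| ≤ ε → P.real {ω | f r < X ω} ≤ C2 * q r) :
    C1 * ((∫ r in (-ε)..ε, P.real {ω | r < R ω} * q' r) - q ε * P.real {ω | ε < R ω})
      ≤ P.real {ω | R ω ∈ Set.Ioc (-ε) ε ∧ f (R ω) < X ω} ∧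
    P.real {ω | R ω ∈ Set.Ioc (-ε) ε ∧ f (R ω) < X ω} ≤
      C2 * (q (-ε) * P.real {ω | -ε < R ω} + ∫ r in (-ε)..ε, P.real {ω | r < R ω} * q' r) := by
  set I := Set.Ioc (-ε) ε with hI
  have hIm : MeasurableSet I := measurableSet_Ioc
  set Φ : ℝ → ℝ := fun x => ∫ r in I, (Set.Iio x).indicator q' r with hΦ
  have hmono : Monotone q := monotone_of_deriv_nonneg (fun r => (hq r).differentiableAt)
    (fun r => by rw [(hq r).deriv]; exact hq'0 r)
  have hqi : ∀ c d, IntervalIntegrable q' volume c d := fun c d => hq'c.intervalIntegrable c d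
  have ftc : ∀ c d, ∫ r in c..d, q' r = q d - q c := fun c d =>
    intervalIntegral.integral_eq_sub_of_hasDerivAt (fun r _ => hq r) (hqi c d)
  have hΦ0 : ∀ x, 0 ≤ Φ x := fun x => integral_nonneg fun r => Set.indicator_nonneg (fun r _ => hq'0 r) r
  have hΦm : ∀ x, x ∈ I → Φ x = q x - q (-ε) := by
    intro x hx
    simp only [hΦ]
    rw [setIntegral_indicator measurableSet_Iio, ← ftc, intervalIntegral.integral_of_le hx.1.le,
      integral_Ioc_eq_integral_Ioo]
    congr 2
    ext r; simp only [hI, Set.mem_inter_iff, Set.mem_Ioc, Set.mem_Iio, Set.mem_Ioo]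
    constructor
    · rintro ⟨⟨a, _⟩, b⟩; exact ⟨a, b⟩
    · rintro ⟨a, b⟩; exact ⟨⟨a, b.le.trans hx.2⟩, b⟩
  have hΦl : ∀ x, x ≤ -ε → Φ x = 0 := by
    intro x hx
    simp only [hΦ]
    rw [setIntegral_indicator measurableSet_Iio]
    have : I ∩ Set.Iio x = ∅ := by
      ext r; simp only [hI, Set.mem_inter_iff, Set.mem_Ioc, Set.mem_Iio, Set.mem_empty_iff_false, iff_false]
      rintro ⟨⟨a, _⟩, b⟩; linarith
    simp [this]
  have hΦr : ∀ x, ε < x → Φ x ≤ q ε := by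
    intro x hx
    simp only [hΦ]
    rw [setIntegral_indicator measurableSet_Iio]
    have : I ∩ Set.Iio x = I := by
      rw [Set.inter_eq_left]; intro r hr; exact lt_of_le_of_lt hr.2 hx
    rw [this, hI, ← intervalIntegral.integral_of_le (by linarith), ftc]
    linarith [hq0 (-ε)]
  -- Fubini
  have hq'I : Integrable q' (volume.restrict I) := (hqi (-ε) ε).1
  have hFi : Integrable (Function.uncurry fun ω r => (Set.Iio (R ω)).indicator q' r)
      (P.prod (volume.restrict I)) := by
    have hb : Integrable (fun p : Ω × ℝ => (1:ℝ) * q' p.2) (P.prod (volume.restrict I)) :=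
      (integrable_const (1:ℝ)).mul_prod hq'I
    have hme : MeasurableSet {p : Ω × ℝ | p.2 < R p.1} := measurableSet_lt measurable_snd (hR.comp measurable_fst)
    have := hb.indicator hme
    refine this.congr (Eventually.of_forall fun p => ?_)
    simp only [Function.uncurry, Set.indicator, Set.mem_Iio, one_mul]
    rfl
  have fub : ∫ ω, Φ (R ω) ∂P = ∫ r in (-ε)..ε, P.real {ω | r < R ω} * q' r := by
    simp only [hΦ]
    rw [integral_integral_swap hFi, intervalIntegral.integral_of_le (by linarith)]
    refine integral_congr_ae (Eventually.of_forall fun r => ?_)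
    have : (fun ω => (Set.Iio (R ω)).indicator q' r) = {ω | r < R ω}.indicator (fun _ => q' r) := by
      ext ω; simp only [Set.indicator, Set.mem_Iio]; rfl
    show ∫ ω, (Set.Iio (R ω)).indicator q' r ∂P = _
    rw [this, integral_indicator_const _ (measurableSet_lt measurable_const hR), smul_eq_mul]
  have hΦi : Integrable (fun ω => Φ (R ω)) P := hFi.integral_prod_left
  have hRI : MeasurableSet (R ⁻¹' I) := hR hIm
  have hqint : IntegrableOn (fun ω => q (R ω)) (R ⁻¹' I) P := by
    refine Measure.integrableOn_of_bounded (M := q ε) (measure_ne_top _ _) (hmono.measurable.comp hR).aestronglyMeasurable ?_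
    refine (ae_restrict_iff' hRI).2 (Eventually.of_forall fun ω hω => ?_)
    rw [Real.norm_of_nonneg (hq0 _)]
    exact hmono hω.2
  have hSm : Measurable fun r => P.real {ω | f r < X ω} := by
    have : Antitone fun t => P.real {ω | t < X ω} := fun s t hst =>
      measureReal_mono (fun ω (hω : t < X ω) => lt_of_le_of_lt hst hω)
    exact this.measurable.comp hf
  have hSint : IntegrableOn (fun ω => P.real {ω' | f (R ω) < X ω'}) (R ⁻¹' I) P := by
    refine Measure.integrableOn_of_bounded (M := 1) (measure_ne_top _ _) (hSm.comp hR).aestronglyMeasurable ?_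
    refine Eventually.of_forall fun ω => ?_
    rw [Real.norm_of_nonneg measureReal_nonneg]
    exact measureReal_le_one
  have habs : ∀ r ∈ I, |r| ≤ ε := fun r hr => abs_le.2 ⟨hr.1.le, hr.2⟩
  rw [mix P X R hX hR hind f hf I hIm]
  have up : ∫ ω in R ⁻¹' I, P.real {ω' | f (R ω) < X ω'} ∂P ≤ C2 * ∫ ω in R ⁻¹' I, q (R ω) ∂P := by
    rw [← integral_const_mul]
    exact setIntegral_mono_on hSint (hqint.const_mul C2) hRI fun ω hω => h2 _ (habs _ hω)
  have lo : C1 * ∫ ω in R ⁻¹' I, q (R ω) ∂P ≤ ∫ ω in R ⁻¹' I, P.real {ω' | f (R ω) < X ω'} ∂P := by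
    rw [← integral_const_mul]
    exact setIntegral_mono_on (hqint.const_mul C1) hSint hRI fun ω hω => h1 _ (habs _ hω)
  have mA : MeasurableSet {ω | -ε < R ω} := measurableSet_lt measurable_const hR
  have mB : MeasurableSet {ω | ε < R ω} := measurableSet_lt measurable_const hR
  have iq := hqint.integrable_indicator hRI
  constructor
  · refine le_trans (mul_le_mul_of_nonneg_left ?_ hC1) lo
    rw [← fub, ← integral_indicator hRI, sub_le_iff_le_add, mul_comm (q ε), ← smul_eq_mul (P.real _),
      ← integral_indicator_const _ mB, ← integral_add iq ((integrable_const _).indicator mB)]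
    refine integral_mono hΦi (iq.add ((integrable_const _).indicator mB)) fun ω => ?_
    show Φ (R ω) ≤ (R ⁻¹' I).indicator (fun ω => q (R ω)) ω + {ω | ε < R ω}.indicator (fun _ => q ε) ω
    by_cases c1 : R ω ≤ -ε
    · rw [hΦl _ c1]
      exact add_nonneg (Set.indicator_nonneg (fun _ _ => hq0 _) _) (Set.indicator_nonneg (fun _ _ => hq0 _) _)
    by_cases c2 : ε < R ω
    · rw [Set.indicator_of_mem (show ω ∈ {ω | ε < R ω} from c2)]
      have := Set.indicator_nonneg (s := R ⁻¹' I) (f := fun ω => q (R ω)) (fun _ _ => hq0 _) ω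
      linarith [hΦr _ c2]
    · have hm : R ω ∈ I := ⟨not_le.1 c1, not_lt.1 c2⟩
      rw [Set.indicator_of_mem (show ω ∈ R ⁻¹' I from hm), hΦm _ hm]
      have := Set.indicator_nonneg (s := {ω | ε < R ω}) (f := fun _ => q ε) (fun _ _ => hq0 _) ω
      linarith [hq0 (-ε)]
  · refine le_trans up (mul_le_mul_of_nonneg_left ?_ hC2)
    rw [← fub, ← integral_indicator hRI, mul_comm (q _), ← smul_eq_mul (P.real _),
      ← integral_indicator_const _ mA, ← integral_add ((integrable_const _).indicator mA) hΦi]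
    refine integral_mono iq (((integrable_const _).indicator mA).add hΦi) fun ω => ?_
    show (R ⁻¹' I).indicator (fun ω => q (R ω)) ω ≤ {ω | -ε < R ω}.indicator (fun _ => q (-ε)) ω + Φ (R ω)
    by_cases hm : R ω ∈ I
    · rw [Set.indicator_of_mem (show ω ∈ R ⁻¹' I from hm), Set.indicator_of_mem (show ω ∈ {ω | -ε < R ω} from hm.1), hΦm _ hm]
      linarith
    · rw [Set.indicator_of_notMem (show ω ∉ R ⁻¹' I from hm)]
      exact add_nonneg (Set.indicator_nonneg (fun _ _ => hq0 _) _) (hΦ0 _)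

lemma far {Ω : Type*} [MeasurableSpace Ω] (P : Measure Ω) [IsProbabilityMeasure P]
    (Z1 Z2 : Ω → ℝ) (hZ1 : Measurable Z1) (hZ2 : Measurable Z2) (hind : IndepFun Z1 Z2 P)
    (h1 : ∀ θ, 0 < θ → ∀ᶠ z in atTop, exp (-(θ * z)) ≤ P.real {ω | z < Z1 ω} * exp z ∧
      P.real {ω | z < Z1 ω} * exp z ≤ exp (θ * z))
    (h2 : ∀ θ, 0 < θ → ∀ᶠ z in atTop, exp (-(θ * z)) ≤ P.real {ω | z < Z2 ω} * exp z ∧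
      P.real {ω | z < Z2 ω} * exp z ≤ exp (θ * z))
    (a b γ : ℝ) (ha : 0 < a) (hb : 0 < b) (hγ : 0 < γ) :
    Tendsto (fun N : ℝ => P.real {ω | N * (a + b + γ) ≤ Z1 ω + Z2 ω} /
      (√N * P.real {ω | a * N < Z1 ω} * P.real {ω | b * N < Z2 ω})) atTop (𝓝 0) := by
  set θ := γ / (2 * (3 * (a + b) + 2 * γ)) with hθ
  have hθ0 : 0 < θ := by positivity
  have hθe : θ * (2 * (3 * (a + b) + 2 * γ)) = γ := by rw [hθ]; field_simp
  have hθ1 : θ < 1 / 2 := by nlinarith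
  set s := 1 - 2 * θ with hs
  have hs0 : 0 < s := by linarith
  have up : ∀ Z : Ω → ℝ, (∀ θ, 0 < θ → ∀ᶠ z in atTop, exp (-(θ * z)) ≤ P.real {ω | z < Z ω} * exp z ∧
      P.real {ω | z < Z ω} * exp z ≤ exp (θ * z)) →
      ∀ᶠ z in atTop, P.real {ω | z < Z ω} ≤ exp (-((1 - θ) * z)) := by
    intro Z hZ
    filter_upwards [hZ θ hθ0] with z hz
    have := mul_le_mul_of_nonneg_right hz.2 (exp_pos (-z)).le
    rw [mul_assoc, ← exp_add, ← exp_add, add_neg_cancel, exp_zero, mul_one] at this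
    refine this.trans (le_of_eq ?_); congr 1; ring
  have low : ∀ Z : Ω → ℝ, (∀ θ, 0 < θ → ∀ᶠ z in atTop, exp (-(θ * z)) ≤ P.real {ω | z < Z ω} * exp z ∧
      P.real {ω | z < Z ω} * exp z ≤ exp (θ * z)) →
      ∀ᶠ z in atTop, exp (-((1 + θ) * z)) ≤ P.real {ω | z < Z ω} := by
    intro Z hZ
    filter_upwards [hZ θ hθ0] with z hz
    have := mul_le_mul_of_nonneg_right hz.1 (exp_pos (-z)).le
    rw [mul_assoc, ← exp_add, ← exp_add, add_neg_cancel, exp_zero, mul_one] at this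
    refine le_trans (le_of_eq ?_) this; congr 1; ring
  have m1 := exp_moment P Z1 hZ1 s (1 - θ) hs0 (by linarith) (up Z1 h1)
  have m2 := exp_moment P Z2 hZ2 s (1 - θ) hs0 (by linarith) (up Z2 h2)
  have m12 : Integrable (fun ω => exp (s * (Z1 + Z2) ω)) P := hind.integrable_exp_mul_add m1 m2
  set M := mgf (Z1 + Z2) P s with hM
  have hM0 : 0 ≤ M := mgf_nonneg
  have ch : ∀ w, P.real {ω | w ≤ Z1 ω + Z2 ω} ≤ exp (-s * w) * M := fun w =>
    measure_ge_le_exp_mul_mgf w hs0.le m12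
  set η := s * (a + b + γ) - (1 + θ) * (a + b) with hη
  have hη0 : 0 < η := by
    have : η = γ / 2 := by rw [hη, hs]; nlinarith
    rw [this]; positivity
  have lim : Tendsto (fun N : ℝ => M * exp (-(η * N))) atTop (𝓝 0) := by
    have := (tendsto_exp_neg_atTop_nhds_zero.comp (tendsto_id.const_mul_atTop hη0)).const_mul M
    simpa using this
  have ta : Tendsto (fun N : ℝ => a * N) atTop atTop := tendsto_id.const_mul_atTop ha
  have tb : Tendsto (fun N : ℝ => b * N) atTop atTop := tendsto_id.const_mul_atTop hb
  refine squeeze_zero' (Eventually.of_forall fun N => by positivity) ?_ lim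
  filter_upwards [ta.eventually (low Z1 h1), tb.eventually (low Z2 h2), eventually_ge_atTop 1] with N l1 l2 hN
  have hsq : 1 ≤ √N := one_le_sqrt.2 hN
  have p1 := lt_of_lt_of_le (exp_pos _) l1
  have p2 := lt_of_lt_of_le (exp_pos _) l2
  rw [div_le_iff₀ (by positivity)]
  have l3 : exp (-((1 + θ) * (a * N))) * exp (-((1 + θ) * (b * N))) ≤ √N * P.real {ω | a * N < Z1 ω} * P.real {ω | b * N < Z2 ω} := by
    have : exp (-((1 + θ) * (a * N))) * exp (-((1 + θ) * (b * N))) ≤ P.real {ω | a * N < Z1 ω} * P.real {ω | b * N < Z2 ω} := by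
      gcongr
    rw [mul_assoc]
    nlinarith [mul_pos p1 p2]
  refine (ch _).trans (le_trans (le_of_eq ?_) (mul_le_mul_of_nonneg_left l3 (by positivity)))
  rw [mul_assoc, ← exp_add, ← exp_add, mul_comm]
  congr 2
  rw [hη]; ring

lemma core {Ω : Type*} [MeasurableSpace Ω] (P : Measure Ω) [IsProbabilityMeasure P]
    (Z1 Z2 : Ω → ℝ) (hZ1 : Measurable Z1) (hZ2 : Measurable Z2) (hind : IndepFun Z1 Z2 P)
    (hZ2p : ∀ᵐ ω ∂P, 0 < Z2 ω)
    (hp1 : ∀ z, 0 < P.real {ω | z < Z1 ω}) (hp2 : ∀ z, 0 < P.real {ω | z < Z2 ω})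
    (ρ1 ρ2 : ℝ)
    (hG1 : ∀ x : ℝ, 0 < x → Tendsto (fun z => (P.real {ω | z * x < Z1 ω} * exp (z * x)) /
      (P.real {ω | z < Z1 ω} * exp z)) atTop (𝓝 (x ^ ρ1)))
    (hG2 : ∀ x : ℝ, 0 < x → Tendsto (fun z => (P.real {ω | z * x < Z2 ω} * exp (z * x)) /
      (P.real {ω | z < Z2 ω} * exp z)) atTop (𝓝 (x ^ ρ2)))
    (a b : ℝ) (ha : 0 < a) (hb : 0 < b) :
    Tendsto (fun N : ℝ => P.real {ω | a * N * exp (-(b * (log (Z2 ω / (b * N)) / a))) < Z1 ω} /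
      (√N * P.real {ω | a * N < Z1 ω} * P.real {ω | b * N < Z2 ω})) atTop
      (𝓝 (a * b * √(2 * π / (a * b * (a + b))))) := by
  have hanti : ∀ Z : Ω → ℝ, Measurable fun z => P.real {ω | z < Z ω} := by
    intro Z
    have : Antitone fun t => P.real {ω | t < Z ω} := fun s t hst =>
      measureReal_mono (fun ω (hω : t < Z ω) => lt_of_le_of_lt hst hω)
    exact this.measurable
  obtain ⟨so1, se1⟩ := rv_props (fun z => P.real {ω | z < Z1 ω} * exp z) ((hanti Z1).mul measurable_exp)
    (fun z => mul_pos (hp1 z) (exp_pos z)) ρ1 hG1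
  obtain ⟨so2, se2⟩ := rv_props (fun z => P.real {ω | z < Z2 ω} * exp z) ((hanti Z2).mul measurable_exp)
    (fun z => mul_pos (hp2 z) (exp_pos z)) ρ2 hG2
  set Λ := a * b * √(2 * π / (a * b * (a + b))) with hΛ
  have hΛ0 : 0 < Λ := by positivity
  have ta : Tendsto (fun N : ℝ => a * N) atTop atTop := tendsto_id.const_mul_atTop ha
  have tb : Tendsto (fun N : ℝ => b * N) atTop atTop := tendsto_id.const_mul_atTop hb
  have key : ∀ δ, 0 < δ → δ < 1 → ∃ lo up : ℝ → ℝ, Tendsto lo atTop (𝓝 ((1 - δ) ^ 2 * Λ)) ∧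
      Tendsto up atTop (𝓝 ((1 + δ) ^ 2 * Λ)) ∧ ∀ᶠ N in atTop,
      lo N ≤ P.real {ω | a * N * exp (-(b * (log (Z2 ω / (b * N)) / a))) < Z1 ω} /
      (√N * P.real {ω | a * N < Z1 ω} * P.real {ω | b * N < Z2 ω}) ∧
      P.real {ω | a * N * exp (-(b * (log (Z2 ω / (b * N)) / a))) < Z1 ω} /
      (√N * P.real {ω | a * N < Z1 ω} * P.real {ω | b * N < Z2 ω}) ≤ up N := by
    intro δ hδ hδ1
    obtain ⟨ε1, hε1, ev1⟩ := so1 δ hδ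
    obtain ⟨ε2, hε2, ev2⟩ := so2 δ hδ
    set ε := min (ε1 / b) (ε2 / a) with hε
    have hε0 : 0 < ε := by positivity
    have hεb : b * ε ≤ ε1 := by
      have : ε ≤ ε1 / b := min_le_left _ _
      rw [le_div_iff₀ hb] at this; linarith
    have hεa : a * ε ≤ ε2 := by
      have : ε ≤ ε2 / a := min_le_right _ _
      rw [le_div_iff₀ ha] at this; linarith
    set k := min (b * a ^ 2 / 2) (a * b ^ 2 / 2) with hk
    have hk0 : 0 < k := by positivity
    set γ := k * ε ^ 2 with hγ
    have hγ0 : 0 < γ := by positivity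
    have fa := far P Z1 Z2 hZ1 hZ2 hind se1 se2 a b γ ha hb hγ0
    set K : ℝ → ℝ := fun N => √N * ∫ r in (-ε)..ε, exp (-(b * r)) * exp (-(N * phi a b r)) with hK
    have lap : Tendsto K atTop (𝓝 (√(2 * π / (a * b * (a + b))))) := laplace a b ε ha hb hε0
    have expl : ∀ r, |r| = ε → Tendsto (fun N : ℝ => exp (-(N * phi a b r)) / √N) atTop (𝓝 0) := by
      intro r hr
      have hph : 0 < phi a b r := by
        refine lt_of_lt_of_le ?_ (phi_ge a b r ha hb)
        rw [← sq_abs r, hr]; positivity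
      have := tendsto_exp_neg_atTop_nhds_zero.comp (tendsto_id.atTop_mul_const hph)
      exact this.div_atTop tendsto_sqrt_atTop
    refine ⟨fun N => (1 - δ) ^ 2 * (a * b * K N) - (1 - δ) * (1 + δ) * (exp (-(N * phi a b ε)) / √N),
      fun N => (1 + δ) ^ 2 * (a * b * K N) + (1 + δ) ^ 2 * (exp (-(N * phi a b (-ε))) / √N) +
        P.real {ω | N * (a + b + γ) ≤ Z1 ω + Z2 ω} /
      (√N * P.real {ω | a * N < Z1 ω} * P.real {ω | b * N < Z2 ω}), ?_, ?_, ?_⟩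
    · have := ((lap.const_mul (a * b)).const_mul ((1 - δ) ^ 2)).sub ((expl ε (abs_of_pos hε0)).const_mul ((1 - δ) * (1 + δ)))
      rwa [mul_zero, sub_zero] at this
    · have := (((lap.const_mul (a * b)).const_mul ((1 + δ) ^ 2)).add ((expl (-ε) (by rw [abs_neg, abs_of_pos hε0])).const_mul ((1 + δ) ^ 2))).add fa
      rwa [mul_zero, add_zero, add_zero] at this
    filter_upwards [ta.eventually ev1, tb.eventually ev2, eventually_gt_atTop 0] with N e1 e2 hN
    have hsN : 0 < √N := sqrt_pos.2 hN
    have hNN : √N * √N = N := mul_self_sqrt hN.le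
    set R : Ω → ℝ := fun ω => log (Z2 ω / (b * N)) / a with hR
    have hRm : Measurable R := by simp only [hR]; fun_prop
    have hindR : IndepFun Z1 R P := by
      have : Measurable fun z : ℝ => log (z / (b * N)) / a := by fun_prop
      exact hind.comp measurable_id this
    set t1 := P.real {ω | a * N < Z1 ω} with ht1
    set t2 := P.real {ω | b * N < Z2 ω} with ht2
    have ht1p : 0 < t1 := hp1 _
    have ht2p : 0 < t2 := hp2 _
    set q : ℝ → ℝ := fun r => exp (a * N * (1 - exp (-(b * r)))) with hq
    set q' : ℝ → ℝ := fun r => a * b * N * exp (-(b * r)) * q r with hq'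
    have hqd : ∀ r, HasDerivAt q (q' r) r := by
      intro r
      have h0 : HasDerivAt (fun r : ℝ => -(b * r)) (-(b * 1)) r := ((hasDerivAt_id r).const_mul b).neg
      have h1 := ((h0.exp.const_sub 1).const_mul (a * N)).exp
      convert h1 using 1
      simp only [hq', hq]; ring
    have b1 : ∀ r, |r| ≤ ε → (1 - δ) * t1 * q r ≤ P.real {ω | a * N * exp (-(b * r)) < Z1 ω} ∧
        P.real {ω | a * N * exp (-(b * r)) < Z1 ω} ≤ (1 + δ) * t1 * q r := by
      intro r hr
      have := e1 (-(b * r)) (by rw [abs_neg, abs_mul, abs_of_pos hb]; nlinarith)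
      have hqe : q r = exp (a * N) * exp (-(a * N * exp (-(b * r)))) := by
        rw [← exp_add]; simp only [hq]; congr 1; ring
      have hee : exp (a * N * exp (-(b * r))) * exp (-(a * N * exp (-(b * r)))) = 1 := by
        rw [← exp_add]; simp
      have hpp := (exp_pos (-(a * N * exp (-(b * r))))).le
      constructor
      · have := mul_le_mul_of_nonneg_right this.1 hpp
        rw [mul_assoc (P.real _), hee, mul_one] at this
        rw [hqe]; refine le_trans (le_of_eq ?_) this; ring
      · have := mul_le_mul_of_nonneg_right this.2 hpp
        rw [mul_assoc (P.real _), hee, mul_one] at this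
        rw [hqe]; refine le_trans this (le_of_eq ?_); ring
    have hRe : ∀ r, P.real {ω | r < R ω} = P.real {ω | b * N * exp (a * r) < Z2 ω} := by
      intro r
      refine measureReal_congr ?_
      filter_upwards [hZ2p] with ω hω
      have : r < R ω ↔ b * N * exp (a * r) < Z2 ω := by
        simp only [hR]
        rw [lt_div_iff₀ ha, lt_log_iff_exp_lt (by positivity), lt_div_iff₀ (by positivity), mul_comm r, mul_comm (exp _)]
      exact propext this
    set w : ℝ → ℝ := fun r => exp (b * N * (1 - exp (a * r))) with hw
    have b2 : ∀ r, |r| ≤ ε → (1 - δ) * t2 * w r ≤ P.real {ω | r < R ω} ∧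
        P.real {ω | r < R ω} ≤ (1 + δ) * t2 * w r := by
      intro r hr
      rw [hRe]
      have := e2 (a * r) (by rw [abs_mul, abs_of_pos ha]; nlinarith)
      have hqe : w r = exp (b * N) * exp (-(b * N * exp (a * r))) := by
        rw [← exp_add]; simp only [hw]; congr 1; ring
      have hee : exp (b * N * exp (a * r)) * exp (-(b * N * exp (a * r))) = 1 := by
        rw [← exp_add]; simp
      have hpp := (exp_pos (-(b * N * exp (a * r)))).le
      constructor
      · have := mul_le_mul_of_nonneg_right this.1 hpp
        rw [mul_assoc (P.real _), hee, mul_one] at this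
        rw [hqe]; refine le_trans (le_of_eq ?_) this; ring
      · have := mul_le_mul_of_nonneg_right this.2 hpp
        rw [mul_assoc (P.real _), hee, mul_one] at this
        rw [hqe]; refine le_trans this (le_of_eq ?_); ring
    have hqw : ∀ r, w r * q r = exp (-(N * phi a b r)) := by
      intro r; simp only [hq, hw, phi]; rw [← exp_add]; congr 1; ring
    have hqc : Continuous q := by simp only [hq]; fun_prop
    have hwc : Continuous w := by simp only [hw]; fun_prop
    have hq'c : Continuous q' := by simp only [hq']; fun_prop
    have hq0 : ∀ r, 0 ≤ q r := fun r => (exp_pos _).le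
    have hq'0 : ∀ r, 0 ≤ q' r := fun r => by simp only [hq']; have := hq0 r; positivity
    obtain ⟨mb1, mb2⟩ := main_bounds P Z1 R hZ1 hRm hindR (fun r => a * N * exp (-(b * r)))
      (by fun_prop) ε hε0 q q' hqd hq'c hq0 hq'0 ((1 - δ) * t1) ((1 + δ) * t1)
      (mul_nonneg (by linarith) ht1p.le) (by positivity) (fun r hr => (b1 r hr).1) (fun r hr => (b1 r hr).2)
    set J := ∫ r in (-ε)..ε, P.real {ω | r < R ω} * q' r with hJ
    have hKint : ∫ r in (-ε)..ε, w r * q' r = a * b * √N * K N := by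
      have : ∀ r, w r * q' r = a * b * N * (exp (-(b * r)) * exp (-(N * phi a b r))) := by
        intro r; rw [← hqw]; simp only [hq']; ring
      simp_rw [this]
      rw [intervalIntegral.integral_const_mul]
      simp only [hK]
      linear_combination (-(a * b) * ∫ r in (-ε)..ε, exp (-(b * r)) * exp (-(N * phi a b r))) * hNN
    have iJ : IntervalIntegrable (fun r => P.real {ω | r < R ω} * q' r) volume (-ε) ε := by
      have : Antitone fun t => P.real {ω | t < R ω} := fun s t hst =>
        measureReal_mono (fun ω (hω : t < R ω) => lt_of_le_of_lt hst hω)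
      exact (this.intervalIntegrable).mul_continuousOn hq'c.continuousOn
    have iw : ∀ C : ℝ, IntervalIntegrable (fun r => C * (w r * q' r)) volume (-ε) ε := fun C =>
      (continuous_const.mul (hwc.mul hq'c)).intervalIntegrable _ _
    have Jlo : (1 - δ) * t2 * (a * b * √N * K N) ≤ J := by
      rw [← hKint, ← intervalIntegral.integral_const_mul]
      refine intervalIntegral.integral_mono_on (by linarith) (iw _) iJ fun r hr => ?_
      have := mul_le_mul_of_nonneg_right (b2 r (abs_le.2 hr)).1 (hq'0 r)
      linarith
    have Jup : J ≤ (1 + δ) * t2 * (a * b * √N * K N) := by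
      rw [← hKint, ← intervalIntegral.integral_const_mul]
      refine intervalIntegral.integral_mono_on (by linarith) iJ (iw _) fun r hr => ?_
      have := mul_le_mul_of_nonneg_right (b2 r (abs_le.2 hr)).2 (hq'0 r)
      linarith
    have hW : 0 < √N * t1 * t2 := by positivity
    have bl : q ε * P.real {ω | ε < R ω} ≤ (1 + δ) * t2 * exp (-(N * phi a b ε)) := by
      rw [← hqw]
      have := mul_le_mul_of_nonneg_right (b2 ε (abs_of_pos hε0).le).2 (hq0 ε)
      linarith
    have bu : q (-ε) * P.real {ω | -ε < R ω} ≤ (1 + δ) * t2 * exp (-(N * phi a b (-ε))) := by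
      rw [← hqw]
      have := mul_le_mul_of_nonneg_right (b2 (-ε) (by rw [abs_neg, abs_of_pos hε0])).2 (hq0 (-ε))
      linarith
    constructor
    · rw [le_div_iff₀ hW]
      have s1 : P.real {ω | R ω ∈ Set.Ioc (-ε) ε ∧ a * N * exp (-(b * R ω)) < Z1 ω} ≤
          P.real {ω | a * N * exp (-(b * R ω)) < Z1 ω} := measureReal_mono fun ω hω => hω.2
      refine le_trans ?_ (mb1.trans s1)
      refine le_trans (le_of_eq ?_) (mul_le_mul_of_nonneg_left (sub_le_sub Jlo bl) (mul_nonneg (by linarith) ht1p.le))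
      field_simp
    · rw [div_le_iff₀ hW]
      have s1 : P.real {ω | a * N * exp (-(b * R ω)) < Z1 ω} ≤
          P.real {ω | R ω ∈ Set.Ioc (-ε) ε ∧ a * N * exp (-(b * R ω)) < Z1 ω} +
          P.real {ω | N * (a + b + γ) ≤ Z1 ω + Z2 ω} := by
        refine le_trans ?_ (measureReal_union_le _ _)
        refine ENNReal.toReal_mono (measure_ne_top _ _) (measure_mono_ae ?_)
        filter_upwards [hZ2p] with ω hω
        intro (hE : a * N * exp (-(b * R ω)) < Z1 ω)
        by_cases hm : R ω ∈ Set.Ioc (-ε) ε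
        · exact Or.inl ⟨hm, hE⟩
        · refine Or.inr ?_
          show N * (a + b + γ) ≤ Z1 ω + Z2 ω
          have hz : Z2 ω = b * N * exp (a * R ω) := by
            simp only [hR]
            rw [mul_div_cancel₀ _ ha.ne', exp_log (by positivity)]
            field_simp
          have hR2 : ε ^ 2 ≤ R ω ^ 2 := by
            by_contra hc
            have := abs_lt_of_sq_lt_sq (not_le.1 hc) hε0.le
            exact hm ⟨(abs_lt.1 this).1, (abs_lt.1 this).2.le⟩
          have hph := phi_ge a b (R ω) ha hb
          rw [← hk] at hph
          have h3 : γ ≤ phi a b (R ω) := le_trans (mul_le_mul_of_nonneg_left hR2 hk0.le) hph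
          have h4 := mul_le_mul_of_nonneg_left h3 hN.le
          have h5 : N * phi a b (R ω) = a * N * exp (-(b * R ω)) + b * N * exp (a * R ω) - N * (a + b) := by
            simp only [phi]; ring
          linarith
      refine s1.trans ?_
      have s2 := mul_le_mul_of_nonneg_left (add_le_add bu Jup) (show 0 ≤ (1 + δ) * t1 by positivity)
      have s3 : P.real {ω | N * (a + b + γ) ≤ Z1 ω + Z2 ω} / (√N * t1 * t2) * (√N * t1 * t2) =
        P.real {ω | N * (a + b + γ) ≤ Z1 ω + Z2 ω} := div_mul_cancel₀ _ hW.ne'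
      rw [add_mul, s3]
      refine add_le_add ((mb2.trans s2).trans (le_of_eq ?_)) le_rfl
      field_simp
      ring
  have cl : Tendsto (fun δ : ℝ => (1 - δ) ^ 2 * Λ) (𝓝[>] 0) (𝓝 Λ) := by
    have : Continuous fun δ : ℝ => (1 - δ) ^ 2 * Λ := by fun_prop
    have := this.tendsto 0
    simp only [sub_zero, one_pow, one_mul] at this
    exact this.mono_left nhdsWithin_le_nhds
  have cu : Tendsto (fun δ : ℝ => (1 + δ) ^ 2 * Λ) (𝓝[>] 0) (𝓝 Λ) := by
    have : Continuous fun δ : ℝ => (1 + δ) ^ 2 * Λ := by fun_prop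
    have := this.tendsto 0
    simp only [add_zero, one_pow, one_mul] at this
    exact this.mono_left nhdsWithin_le_nhds
  have sm : ∀ᶠ δ : ℝ in 𝓝[>] 0, 0 < δ ∧ δ < 1 := Ioo_mem_nhdsGT one_pos
  refine tendsto_order.2 ⟨fun c hc => ?_, fun c hc => ?_⟩
  · obtain ⟨δ, h1, h2, h3⟩ := ((cl.eventually (lt_mem_nhds hc)).and sm).exists
    obtain ⟨lo, up, l1, l2, l3⟩ := key δ h2 h3
    filter_upwards [l1.eventually (lt_mem_nhds h1), l3] with N x1 x2
    exact x1.trans_le x2.1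
  · obtain ⟨δ, h1, h2, h3⟩ := ((cu.eventually (gt_mem_nhds hc)).and sm).exists
    obtain ⟨lo, up, l1, l2, l3⟩ := key δ h2 h3
    filter_upwards [l2.eventually (gt_mem_nhds h1), l3] with N x1 x2
    exact x2.2.trans_lt x1

lemma trans_Z {Ω : Type*} [MeasurableSpace Ω] (P : Measure Ω) [IsProbabilityMeasure P]
    (Y : Ω → ℝ) (hYp : ∀ᵐ ω ∂P, 0 < Y ω) (L p : ℝ) (hL : 0 < L) (hp : 0 < p)
    (g : ℝ → ℝ) (hg : ∀ u > 0, 0 < g u) (ρ : ℝ) (hrv : RegularlyVarying g ρ)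
    (h : Tendsto (fun u => (P {ω | Y ω > u}).toReal / (g u * exp (-(L * u ^ p)))) atTop (𝓝 1)) :
    (∀ y, 0 ≤ y → P.real {ω | L * y ^ p < L * Y ω ^ p} = P.real {ω | y < Y ω}) ∧
    (∀ z, 0 < P.real {ω | z < L * Y ω ^ p}) ∧
    (∀ u, 0 < P.real {ω | u < Y ω}) ∧
    (∀ x : ℝ, 0 < x → Tendsto (fun z => (P.real {ω | z * x < L * Y ω ^ p} * exp (z * x)) /
      (P.real {ω | z < L * Y ω ^ p} * exp z)) atTop (𝓝 (x ^ (ρ / p)))) := by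
  have hA : ∀ y, 0 ≤ y → P.real {ω | L * y ^ p < L * Y ω ^ p} = P.real {ω | y < Y ω} := by
    intro y hy
    refine measureReal_congr ?_
    filter_upwards [hYp] with ω hω
    have : L * y ^ p < L * Y ω ^ p ↔ y < Y ω := by
      rw [mul_lt_mul_iff_right₀ hL, rpow_lt_rpow_iff hy hω.le hp]
    exact propext this
  have hpos : ∀ u, 0 < P.real {ω | u < Y ω} := by
    intro u
    have := h.eventually (lt_mem_nhds (show (0:ℝ) < 1 from one_pos))
    obtain ⟨v, hv, hvu⟩ := (this.and (eventually_ge_atTop u)).exists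
    have h1 : 0 < P.real {ω | v < Y ω} := by
      refine lt_of_le_of_ne measureReal_nonneg fun h0 => ?_
      have h0' : (P {ω | Y ω > v}).toReal = 0 := h0.symm
      rw [h0', zero_div] at hv
      linarith
    exact h1.trans_le (measureReal_mono fun ω (hω : v < Y ω) => lt_of_le_of_lt hvu hω)
  set U : ℝ → ℝ := fun z => (z / L) ^ (1 / p) with hU
  have hUz : ∀ z, 0 ≤ z → L * U z ^ p = z := by
    intro z hz
    simp only [hU]
    rw [← rpow_mul (by positivity), one_div_mul_cancel hp.ne', rpow_one]
    field_simp
  have hU0 : ∀ z, 0 ≤ z → 0 ≤ U z := fun z hz => by simp only [hU]; positivity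
  have hUx : ∀ z x, 0 ≤ z → 0 < x → U (z * x) = U z * x ^ (1 / p) := by
    intro z x hz hx
    simp only [hU]
    rw [← mul_rpow (by positivity) hx.le]; congr 1; ring
  have hT : ∀ z, 0 ≤ z → P.real {ω | z < L * Y ω ^ p} = P.real {ω | U z < Y ω} := by
    intro z hz
    have := hA (U z) (hU0 z hz)
    rwa [hUz z hz] at this
  have hUt : Tendsto U atTop atTop :=
    (tendsto_rpow_atTop (by positivity)).comp (tendsto_id.atTop_div_const hL)
  refine ⟨hA, fun z => ?_, hpos, fun x hx => ?_⟩
  · have h1 : 0 < P.real {ω | max z 0 < L * Y ω ^ p} := by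
      rw [hT _ (le_max_right _ _)]; exact hpos _
    exact h1.trans_le (measureReal_mono fun ω (hω : _ < _) => lt_of_le_of_lt (le_max_left z 0) hω)
  · have hx' : 0 < x ^ (1 / p) := by positivity
    have l1 := h.comp hUt
    have l2 := h.comp (hUt.atTop_mul_const hx')
    have l3 := (hrv _ hx').comp hUt
    have l4 := (l2.div l1 one_ne_zero).mul l3
    rw [div_one, one_mul, ← rpow_mul hx.le, show 1 / p * ρ = ρ / p by ring] at l4
    refine l4.congr' ?_
    filter_upwards [eventually_gt_atTop 0] with z hz
    simp only [Function.comp, Pi.div_apply]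
    have hzx : 0 < z * x := by positivity
    rw [hT _ hz.le, hT _ hzx.le, ← hUx z x hz.le hx, hUz _ hz.le, hUz _ hzx.le]
    have u1 : 0 < U z := by simp only [hU]; positivity
    have u2 : 0 < U (z * x) := by simp only [hU]; positivity
    have g1 := hg _ u1
    have g2 := hg _ u2
    have q1 := hpos (U z)
    show P.real {ω | U (z * x) < Y ω} / _ / (P.real {ω | U z < Y ω} / _) * _ = _
    rw [exp_neg, exp_neg]
    field_simp

theorem weibullian_product_tail_form
    {Ω : Type*} [MeasureSpace Ω] [IsProbabilityMeasure (ℙ : Measure Ω)]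
    (Y₁ Y₂ : Ω → ℝ) (hY₁ : Measurable Y₁) (hY₂ : Measurable Y₂)
    (hindep : IndepFun Y₁ Y₂)
    (hY₁pos : ∀ᵐ ω ∂ℙ, 0 < Y₁ ω) (hY₂pos : ∀ᵐ ω ∂ℙ, 0 < Y₂ ω)
    (L₁ L₂ p₁ p₂ : ℝ) (hL₁ : 0 < L₁) (hL₂ : 0 < L₂) (hp₁ : 0 < p₁) (hp₂ : 0 < p₂)
    (g₁ g₂ : ℝ → ℝ) (hg₁pos : ∀ u > 0, 0 < g₁ u) (hg₂pos : ∀ u > 0, 0 < g₂ u)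
    (ρ₁ ρ₂ : ℝ) (hg₁ : RegularlyVarying g₁ ρ₁) (hg₂ : RegularlyVarying g₂ ρ₂)
    (h₁ : Tendsto (fun u => (ℙ {ω | Y₁ ω > u}).toReal /
        (g₁ u * Real.exp (-(L₁ * u ^ p₁)))) atTop (𝓝 1))
    (h₂ : Tendsto (fun u => (ℙ {ω | Y₂ ω > u}).toReal /
        (g₂ u * Real.exp (-(L₂ * u ^ p₂)))) atTop (𝓝 1))
    (A B D : ℝ) (hA : A = ((p₁ * L₁) / (p₂ * L₂)) ^ (1 / (p₁ + p₂)))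
    (hB : B = L₁ * A ^ (-p₁) + L₂ * A ^ p₂)
    (hD : D = Real.sqrt (2 * Real.pi * (p₁ * L₁) ^ (p₂ / (p₁ + p₂)) *
        (p₂ * L₂) ^ (p₁ / (p₁ + p₂)) / (p₁ + p₂)))
    (c : ℝ → ℝ) (hc : ∀ u, c u = A * u ^ (p₁ / (p₁ + p₂))) :
    Tendsto (fun u => (ℙ {ω | Y₁ ω * Y₂ ω > u}).toReal /
        (D * u ^ (p₁ * p₂ / (2 * (p₁ + p₂))) * (ℙ {ω | Y₁ ω > u / c u}).toReal *
          (ℙ {ω | Y₂ ω > c u}).toReal)) atTop (𝓝 1) := by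
  obtain ⟨A1, P1, Q1, G1⟩ := trans_Z ℙ Y₁ hY₁pos L₁ p₁ hL₁ hp₁ g₁ hg₁pos ρ₁ hg₁ h₁
  obtain ⟨A2, P2, Q2, G2⟩ := trans_Z ℙ Y₂ hY₂pos L₂ p₂ hL₂ hp₂ g₂ hg₂pos ρ₂ hg₂ h₂
  have hindZ : IndepFun (fun ω => L₁ * Y₁ ω ^ p₁) (fun ω => L₂ * Y₂ ω ^ p₂) (ℙ : Measure Ω) := by
    have m1 : Measurable fun y : ℝ => L₁ * y ^ p₁ := by fun_prop
    have m2 : Measurable fun y : ℝ => L₂ * y ^ p₂ := by fun_prop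
    exact hindep.comp m1 m2
  have C := core (ℙ : Measure Ω) (fun ω => L₁ * Y₁ ω ^ p₁) (fun ω => L₂ * Y₂ ω ^ p₂) (by fun_prop) (by fun_prop)
    hindZ (by filter_upwards [hY₂pos] with ω hω; positivity) P1 P2 _ _ G1 G2 (1 / p₁) (1 / p₂) (by positivity) (by positivity)
  have hs : 0 < p₁ + p₂ := by positivity
  have hA0 : 0 < A := by rw [hA]; positivity
  set m := (p₁ * L₁) ^ (p₂ / (p₁ + p₂)) * (p₂ * L₂) ^ (p₁ / (p₁ + p₂)) with hm
  have hm0 : 0 < m := by positivity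
  set κ := p₁ * p₂ / (p₁ + p₂) with hκ
  have hκ0 : 0 < κ := by positivity
  clear_value m κ
  -- logarithmic identities
  have lA : log A = (log (p₁ * L₁) - log (p₂ * L₂)) / (p₁ + p₂) := by
    rw [hA, log_rpow (by positivity), log_div (by positivity) (by positivity)]; ring
  have lm : log m = p₂ / (p₁ + p₂) * log (p₁ * L₁) + p₁ / (p₁ + p₂) * log (p₂ * L₂) := by
    rw [hm, log_mul (by positivity) (by positivity), log_rpow (by positivity), log_rpow (by positivity)]
  have hcp : ∀ u, 0 < u → 0 < c u := fun u hu => by rw [hc]; positivity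
  have lc : ∀ u, 0 < u → log (c u) = log A + p₁ / (p₁ + p₂) * log u := fun u hu => by
    rw [hc, log_mul hA0.ne' (by positivity), log_rpow hu]
  have I1 : ∀ u, 0 < u → 1 / p₁ * (m * u ^ κ) = L₁ * (u / c u) ^ p₁ := by
    intro u hu
    have := hcp u hu
    refine log_injOn_pos (Set.mem_Ioi.2 (by positivity)) (Set.mem_Ioi.2 (by positivity)) ?_
    rw [log_mul (by positivity) (by positivity), log_mul (by positivity) (by positivity), log_rpow hu,
      log_mul (by positivity) (by positivity), log_rpow (by positivity), log_div hu.ne' this.ne', lc u hu, lA, lm,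
      log_mul hp₁.ne' hL₁.ne', one_div, log_inv, hκ]
    field_simp
    ring
  have I2 : ∀ u, 0 < u → 1 / p₂ * (m * u ^ κ) = L₂ * (c u) ^ p₂ := by
    intro u hu
    have := hcp u hu
    refine log_injOn_pos (Set.mem_Ioi.2 (by positivity)) (Set.mem_Ioi.2 (by positivity)) ?_
    rw [log_mul (by positivity) (by positivity), log_mul (by positivity) (by positivity), log_rpow hu,
      log_mul (by positivity) (by positivity), log_rpow (by positivity), lc u hu, lA, lm,
      log_mul hp₂.ne' hL₂.ne', one_div, log_inv, hκ]
    field_simp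
    ring
  have hNt : Tendsto (fun u : ℝ => m * u ^ κ) atTop atTop :=
    (tendsto_rpow_atTop hκ0).const_mul_atTop hm0
  set Λ := 1 / p₁ * (1 / p₂) * √(2 * π / (1 / p₁ * (1 / p₂) * (1 / p₁ + 1 / p₂))) with hΛ
  have hΛ0 : 0 < Λ := by positivity
  have C2 := (C.comp hNt).div_const Λ
  rw [div_self hΛ0.ne'] at C2
  refine C2.congr' ?_
  filter_upwards [eventually_gt_atTop 0] with u hu
  simp only [Function.comp]
  have hcu := hcp u hu
  have huc : 0 < u / c u := by positivity
  rw [I1 u hu, I2 u hu, A1 _ huc.le, A2 _ hcu.le]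
  have hev : (ℙ : Measure Ω).real {ω | L₁ * (u / c u) ^ p₁ * exp (-(1 / p₂ * (log (L₂ * Y₂ ω ^ p₂ / (L₂ * c u ^ p₂)) / (1 / p₁)))) < L₁ * Y₁ ω ^ p₁}
      = (ℙ {ω | Y₁ ω * Y₂ ω > u}).toReal := by
    refine measureReal_congr ?_
    filter_upwards [hY₁pos, hY₂pos] with ω w1 w2
    have : L₁ * (u / c u) ^ p₁ * exp (-(1 / p₂ * (log (L₂ * Y₂ ω ^ p₂ / (L₂ * c u ^ p₂)) / (1 / p₁)))) < L₁ * Y₁ ω ^ p₁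
        ↔ Y₁ ω * Y₂ ω > u := by
      rw [gt_iff_lt, ← log_lt_log_iff (by positivity) (by positivity), ← log_lt_log_iff hu (by positivity),
        log_mul (by positivity) (by positivity), log_mul (by positivity) (by positivity), log_exp,
        log_mul (by positivity) (by positivity), log_rpow huc, log_rpow w1, log_mul w1.ne' w2.ne',
        log_div hu.ne' hcu.ne', log_div (by positivity) (by positivity), log_mul (by positivity) (by positivity),
        log_mul (by positivity) (by positivity), log_rpow w2, log_rpow hcu]
      have : log L₁ + p₁ * (log u - log (c u)) + -(1 / p₂ * ((log L₂ + p₂ * log (Y₂ ω) - (log L₂ + p₂ * log (c u))) / (1 / p₁)))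
        = log L₁ + p₁ * (log u - log (Y₂ ω)) := by field_simp; ring
      rw [this, add_lt_add_iff_left, mul_lt_mul_iff_right₀ hp₁, sub_lt_iff_lt_add]
    exact propext this
  rw [hev]
  have hDu : D * u ^ (p₁ * p₂ / (2 * (p₁ + p₂))) = √(m * u ^ κ) * Λ := by
    have e1 : u ^ (p₁ * p₂ / (2 * (p₁ + p₂))) = √(u ^ κ) := by
      rw [sqrt_eq_rpow, ← rpow_mul hu.le, hκ]; congr 1; field_simp
    have e2 : D = √(m * (2 * π / (p₁ + p₂))) := by
      rw [hD, hm]; congr 1; ring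
    have e3 : Λ = √(2 * π / (p₁ + p₂)) := by
      rw [hΛ]
      rw [← sqrt_sq (show 0 ≤ 1 / p₁ * (1 / p₂) by positivity), ← sqrt_mul (by positivity)]
      rw [sqrt_sq (show 0 ≤ 1 / p₁ * (1 / p₂) by positivity)]
      congr 1; field_simp; ring
    rw [e1, e2, e3, sqrt_mul hm0.le, sqrt_mul hm0.le]; ring
  rw [hDu, div_div]
  congr 1
  show √(m * u ^ κ) * (ℙ : Measure Ω).real {ω | u / c u < Y₁ ω} * (ℙ : Measure Ω).real {ω | c u < Y₂ ω} * Λ =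
    √(m * u ^ κ) * Λ * (ℙ : Measure Ω).real {ω | u / c u < Y₁ ω} * (ℙ : Measure Ω).real {ω | c u < Y₂ ω}
  ring
end
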